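/- arXiv:2202.03556 — 17 statements merged into one kernel-verified Lean document; each statement's English description precedes it below -/
import Mathlib

section
/- Let c > 1, μ ∈ ℝ, σ > 0 and set λ = μ/σ. The coverage probability P₁(μ,σ,c) = ℙ_{μ,σ}(X − c|X| ≤ μ ≤ X + c|X|) depends on (μ,σ) only through λ, satisfies P₁(μ,σ,c) = P₁(−μ,σ,c), and for λ ≥ 0 it equals Φ(cλ/(c+1)) + 1 − Φ(cλ/(c−1)). -/
open MeasureTheory ProbabilityTheory

/-- The standard normal CDF `Φ`. -/
noncomputable def stdNormalCDF (x : ℝ) : ℝ := ((gaussianReal 0 1) (Set.Iic x)).toReal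

/-- The Gaussian measure on `ℝ` with mean `μ` and variance `σ²`. -/
noncomputable def normalMeasure (μ σ : ℝ) : Measure ℝ := gaussianReal μ (Real.toNNReal (σ ^ 2))

/-- Coverage probability of the Abbott–Rosenblatt interval `(X - c|X|, X + c|X|)`. -/
noncomputable def coverAR (c μ σ : ℝ) : ℝ :=
  ((normalMeasure μ σ) {x : ℝ | x - c * |x| ≤ μ ∧ μ ≤ x + c * |x|}).toReal

lemma measurableSet_coverAR (c μ : ℝ) :
    MeasurableSet {x : ℝ | x - c * |x| ≤ μ ∧ μ ≤ x + c * |x|} := by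
  have h₁ : Measurable fun x : ℝ ↦ x - c * |x| := by fun_prop
  have h₂ : Measurable fun x : ℝ ↦ x + c * |x| := by fun_prop
  exact (measurableSet_le h₁ measurable_const).inter (measurableSet_le measurable_const h₂)

lemma coverAR_neg (c μ σ : ℝ) : coverAR c (-μ) σ = coverAR c μ σ := by
  unfold coverAR normalMeasure
  rw [← gaussianReal_map_neg, Measure.map_apply measurable_neg (measurableSet_coverAR c (-μ))]
  congr 2
  ext x
  simp only [Set.mem_preimage, Set.mem_ofPred_eq, abs_neg]
  constructor <;> rintro ⟨h₁, h₂⟩ <;> constructor <;> linarith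

lemma coverAR_eq_standardized (c μ : ℝ) {σ : ℝ} (hσ : 0 < σ) :
    coverAR c μ σ = coverAR c (μ / σ) 1 := by
  have hmap : normalMeasure μ σ = (normalMeasure (μ / σ) 1).map (σ * ·) := by
    unfold normalMeasure
    rw [gaussianReal_map_const_mul, mul_div_cancel₀ _ hσ.ne']
    congr 1
    ext
    simp [sq_nonneg]
  unfold coverAR
  rw [hmap, Measure.map_apply (measurable_const_mul σ) (measurableSet_coverAR c μ)]
  congr 2
  ext x
  simp only [Set.mem_preimage, Set.mem_ofPred_eq, abs_mul, abs_of_pos hσ, le_div_iff₀ hσ,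
    div_le_iff₀ hσ]
  constructor <;> rintro ⟨h₁, h₂⟩ <;> constructor <;> linarith

lemma stdNormalCDF_sub_eq_real_Ioo {a b : ℝ} (hab : a ≤ b) :
    stdNormalCDF b - stdNormalCDF a = (gaussianReal 0 1).real (Set.Ioo a b) := by
  have := nullSingletonClass_gaussianReal (μ := 0) (v := 1) one_ne_zero
  change (gaussianReal 0 1).real (Set.Iic b) - (gaussianReal 0 1).real (Set.Iic a) = _
  rw [measureReal_congr Ioo_ae_eq_Ioc, ← Set.Iic_union_Ioc_eq_Iic hab,
    measureReal_union (Set.Iic_disjoint_Ioc le_rfl) measurableSet_Ioc, add_sub_cancel_left]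

lemma sub_mem_coverAR_iff {c l : ℝ} (hc : 1 < c) (hl : 0 ≤ l) (w : ℝ) :
    (l - w - c * |l - w| ≤ l ∧ l ≤ l - w + c * |l - w|) ↔
      w ≤ c * l / (c + 1) ∨ c * l / (c - 1) ≤ w := by
  rw [le_div_iff₀ (by linarith), div_le_iff₀ (by linarith)]
  rcases abs_cases (l - w) with ⟨h, hw⟩ | ⟨h, hw⟩ <;> rw [h] <;> constructor
  · rintro ⟨-, h₂⟩
    left; linarith
  · rintro (h₁ | h₁)
    · constructor <;> nlinarith
    · constructor <;> nlinarith
  · rintro ⟨-, h₂⟩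
    right; linarith
  · rintro (h₁ | h₁)
    · constructor <;> nlinarith
    · constructor <;> nlinarith

lemma coverAR_one_of_nonneg {c l : ℝ} (hc : 1 < c) (hl : 0 ≤ l) :
    coverAR c l 1 = stdNormalCDF (c * l / (c + 1)) + 1 - stdNormalCDF (c * l / (c - 1)) := by
  have hab : c * l / (c + 1) ≤ c * l / (c - 1) :=
    div_le_div_of_nonneg_left (by positivity) (by linarith) (by linarith)
  have hmap : normalMeasure l 1 = (gaussianReal 0 1).map (l - ·) := by
    rw [gaussianReal_map_const_sub]
    simp [normalMeasure]
  have hset : (l - ·) ⁻¹' {x : ℝ | x - c * |x| ≤ l ∧ l ≤ x + c * |x|} =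
      (Set.Ioo (c * l / (c + 1)) (c * l / (c - 1)))ᶜ := by
    ext w
    simp only [Set.mem_preimage, Set.mem_ofPred_eq, sub_mem_coverAR_iff hc hl, Set.mem_compl_iff,
      Set.mem_Ioo, not_and_or, not_lt]
  unfold coverAR
  rw [hmap, Measure.map_apply (measurable_const_sub l) (measurableSet_coverAR c l),
    hset, ← measureReal_def, probReal_compl_eq_one_sub measurableSet_Ioo,
    ← stdNormalCDF_sub_eq_real_Ioo hab]
  ring

theorem statement0 (c : ℝ) (hc : 1 < c) :
    (∀ μ₁ σ₁ μ₂ σ₂ : ℝ, 0 < σ₁ → 0 < σ₂ → μ₁ / σ₁ = μ₂ / σ₂ →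
      coverAR c μ₁ σ₁ = coverAR c μ₂ σ₂) ∧
    (∀ μ σ : ℝ, 0 < σ → coverAR c μ σ = coverAR c (-μ) σ) ∧
    (∀ μ σ : ℝ, 0 < σ → 0 ≤ μ / σ →
      coverAR c μ σ =
        stdNormalCDF (c * (μ / σ) / (c + 1)) + 1 - stdNormalCDF (c * (μ / σ) / (c - 1))) := by
  refine ⟨fun μ₁ σ₁ μ₂ σ₂ h₁ h₂ h ↦ ?_, fun μ σ _ ↦ (coverAR_neg c μ σ).symm,
    fun μ σ hσ hl ↦ ?_⟩
  · rw [coverAR_eq_standardized c μ₁ h₁, coverAR_eq_standardized c μ₂ h₂, h]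
  · rw [coverAR_eq_standardized c μ hσ, coverAR_one_of_nonneg hc hl]
end

section
/- Fix c > 1 and define P₁(λ, c) = Φ(cλ/(c+1)) + 1 − Φ(cλ/(c−1)) for λ ≥ 0. Then the function λ ↦ P₁(λ, c) attains its minimum over [0,∞) at the point λ*(c) = ((c² − 1)/(√2 · c^{3/2})) · √(log((c+1)/(c−1))), i.e. P₁(λ*(c), c) ≤ P₁(λ, c) for all λ ≥ 0. -/
open MeasureTheory ProbabilityTheory

theorem hasDerivAt_stdNormalCDF (x : ℝ) :
    HasDerivAt stdNormalCDF (gaussianPDFReal 0 1 x) x := by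
  have hint := integrable_gaussianPDFReal 0 1
  have hcont : Continuous (gaussianPDFReal 0 1) := by
    unfold gaussianPDFReal
    fun_prop
  have heq : stdNormalCDF = fun y => (∫ t in (0 : ℝ)..y, gaussianPDFReal 0 1 t) +
      ∫ t in Set.Iic (0 : ℝ), gaussianPDFReal 0 1 t := by
    funext y
    rw [← intervalIntegral.integral_Iic_sub_Iic hint.integrableOn hint.integrableOn,
      sub_add_cancel, stdNormalCDF, gaussianReal_apply_eq_integral 0 one_ne_zero,
      ENNReal.toReal_ofReal (integral_nonneg fun t => gaussianPDFReal_nonneg 0 1 t)]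
  rw [heq]
  exact (hcont.integral_hasStrictDerivAt 0 x).hasDerivAt.add_const _

/-- If the Gaussian densities with scales `a` and `b` cross at `L`, the narrower one is below
exactly past `L`. -/
theorem mul_gaussianPDFReal_le_iff {a b L : ℝ} (ha : 0 < a) (hab : a < b) (hL : 0 ≤ L)
    (h : (b ^ 2 - a ^ 2) * L ^ 2 = 2 * Real.log (b / a)) {x : ℝ} (hx : 0 ≤ x) :
    (b * gaussianPDFReal 0 1 (b * x) ≤ a * gaussianPDFReal 0 1 (a * x) ↔ L ≤ x) ∧
    (a * gaussianPDFReal 0 1 (a * x) ≤ b * gaussianPDFReal 0 1 (b * x) ↔ x ≤ L) := by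
  have hb : b = a * Real.exp ((b ^ 2 - a ^ 2) * L ^ 2 / 2) := by
    rw [h, mul_div_cancel_left₀ _ two_ne_zero, Real.exp_log (div_pos (ha.trans hab) ha)]
    field_simp
  have hk : 0 < b ^ 2 - a ^ 2 := by nlinarith
  set K : ℝ := (Real.sqrt (2 * Real.pi * (1 : NNReal)))⁻¹ with hK
  have hKpos : 0 < K := by rw [hK]; positivity
  have hA : a * gaussianPDFReal 0 1 (a * x) = a * K * Real.exp (-(a ^ 2 * x ^ 2 / 2)) := by
    rw [gaussianPDFReal, ← hK, ← mul_assoc]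
    congr 2
    simp
    ring
  have hB : b * gaussianPDFReal 0 1 (b * x) =
      a * K * Real.exp ((b ^ 2 - a ^ 2) * L ^ 2 / 2 - b ^ 2 * x ^ 2 / 2) := by
    have hexp : gaussianPDFReal 0 1 (b * x) = K * Real.exp (-(b ^ 2 * x ^ 2 / 2)) := by
      rw [gaussianPDFReal, ← hK]
      congr 2
      simp
      ring
    rw [hexp, sub_eq_add_neg, Real.exp_add]
    nth_rewrite 1 [hb]
    ring
  have haK : 0 < a * K := mul_pos ha hKpos
  rw [hA, hB, mul_le_mul_iff_right₀ haK, mul_le_mul_iff_right₀ haK, Real.exp_le_exp,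
    Real.exp_le_exp, ← sq_le_sq₀ hL hx, ← sq_le_sq₀ hx hL]
  refine ⟨⟨fun hle => ?_, fun hle => ?_⟩, ⟨fun hle => ?_, fun hle => ?_⟩⟩
  · exact le_of_mul_le_mul_left (by linarith) hk
  · linarith [mul_le_mul_of_nonneg_left hle hk.le]
  · exact le_of_mul_le_mul_left (by linarith) hk
  · linarith [mul_le_mul_of_nonneg_left hle hk.le]

theorem stdNormalCDF_sub_stdNormalCDF_min {a b L : ℝ} (ha : 0 < a) (hab : a < b) (hL : 0 ≤ L)
    (h : (b ^ 2 - a ^ 2) * L ^ 2 = 2 * Real.log (b / a)) {l : ℝ} (hl : 0 ≤ l) :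
    stdNormalCDF (a * L) - stdNormalCDF (b * L) ≤ stdNormalCDF (a * l) - stdNormalCDF (b * l) := by
  have hscale (k x : ℝ) : HasDerivAt (fun y => stdNormalCDF (k * y))
      (k * gaussianPDFReal 0 1 (k * x)) x := by
    have := (hasDerivAt_stdNormalCDF (k * x)).comp x ((hasDerivAt_id x).const_mul k)
    simpa [Function.comp_def, mul_comm] using this
  have hderiv (x : ℝ) := (hscale a x).sub (hscale b x)
  have hcont : Continuous ((fun y => stdNormalCDF (a * y)) - fun y => stdNormalCDF (b * y)) :=
    continuous_iff_continuousAt.2 fun x => (hderiv x).continuousAt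
  rcases le_total l L with hlL | hLl
  · refine antitoneOn_of_hasDerivWithinAt_nonpos (convex_Icc 0 L) hcont.continuousOn
      (fun x _ => (hderiv x).hasDerivWithinAt) (fun x hx => ?_) ⟨hl, hlL⟩ ⟨hL, le_rfl⟩ hlL
    have hx' := interior_subset hx
    exact sub_nonpos.2 ((mul_gaussianPDFReal_le_iff ha hab hL h hx'.1).2.2 hx'.2)
  · refine monotoneOn_of_hasDerivWithinAt_nonneg (convex_Ici L) hcont.continuousOn
      (fun x _ => (hderiv x).hasDerivWithinAt) (fun x hx => ?_) Set.self_mem_Ici hLl hLl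
    have hx' : L ≤ x := interior_subset hx
    exact sub_nonneg.2 ((mul_gaussianPDFReal_le_iff ha hab hL h (hL.trans hx')).1.2 hx')

theorem statement1 (c : ℝ) (hc : 1 < c) :
    let P₁ : ℝ → ℝ := fun l =>
      stdNormalCDF (c * l / (c + 1)) + 1 - stdNormalCDF (c * l / (c - 1))
    let lstar : ℝ := ((c ^ 2 - 1) / (Real.sqrt 2 * c ^ ((3 : ℝ) / 2))) *
      Real.sqrt (Real.log ((c + 1) / (c - 1)))
    0 ≤ lstar ∧ ∀ l : ℝ, 0 ≤ l → P₁ lstar ≤ P₁ l := by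
  intro P₁ lstar
  have hc0 : 0 < c := by linarith
  have hc1 : 0 < c - 1 := by linarith
  have hc2 : 0 < c + 1 := by linarith
  have hsq : 0 ≤ c ^ 2 - 1 := by nlinarith
  have hL : 0 ≤ lstar := by positivity
  refine ⟨hL, fun l hl => ?_⟩
  have hlog : 0 ≤ Real.log ((c + 1) / (c - 1)) :=
    Real.log_nonneg ((one_le_div hc1).2 (by linarith))
  have hpow : (c ^ ((3 : ℝ) / 2)) ^ 2 = c ^ 3 := by
    rw [← Real.rpow_natCast, ← Real.rpow_mul hc0.le, ← Real.rpow_natCast]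
    norm_num
  have hLsq : lstar ^ 2 = (c ^ 2 - 1) ^ 2 / (2 * c ^ 3) * Real.log ((c + 1) / (c - 1)) := by
    simp only [lstar]
    rw [mul_pow, div_pow, mul_pow, hpow, Real.sq_sqrt hlog, Real.sq_sqrt zero_le_two]
  have hratio : c / (c - 1) / (c / (c + 1)) = (c + 1) / (c - 1) := by field_simp
  have hmin := stdNormalCDF_sub_stdNormalCDF_min (a := c / (c + 1)) (b := c / (c - 1))
    (div_pos hc0 hc2) (div_lt_div_of_pos_left hc0 hc1 (by linarith)) hL
    (by rw [hLsq, hratio]; field_simp; ring) hl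
  simp only [P₁, mul_div_right_comm c]
  linarith
end

section
/- For every α with 0 < α < 1/2 there exists a constant c = c(α) > 1 such that for all μ ∈ ℝ and all σ > 0, ℙ_{μ,σ}(X − c|X| ≤ μ ≤ X + c|X|) ≥ 1 − α. -/
open MeasureTheory ProbabilityTheory

/-- A Gaussian density at `x` is at most the inverse of the distance from `x` to the mean. -/
lemma abs_sub_mul_gaussianPDFReal_le_one (μ x : ℝ) (v : NNReal) :
    |x - μ| * gaussianPDFReal μ v x ≤ 1 := by
  rcases eq_or_ne v 0 with rfl | hv
  · simp
  have hv' : (0 : ℝ) < v := by positivity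
  have hs : 0 < √(2 * Real.pi * v) := Real.sqrt_pos.2 (by positivity)
  have hsq : √(2 * Real.pi * v) ^ 2 = 2 * Real.pi * v := Real.sq_sqrt (by positivity)
  rw [gaussianPDFReal_def]
  set s := √(2 * Real.pi * v)
  have h_exp : |x - μ| / s ≤ Real.exp ((x - μ) ^ 2 / (2 * v)) :=
    calc |x - μ| / s ≤ (|x - μ| / s) ^ 2 + 1 := by nlinarith [sq_nonneg (|x - μ| / s - 1)]
      _ = (x - μ) ^ 2 / s ^ 2 + 1 := by rw [div_pow, sq_abs]
      _ ≤ (x - μ) ^ 2 / (2 * v) + 1 := by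
        gcongr
        rw [hsq]
        nlinarith [Real.pi_gt_three]
      _ ≤ Real.exp ((x - μ) ^ 2 / (2 * v)) := Real.add_one_le_exp _
  calc |x - μ| * (s⁻¹ * Real.exp (-(x - μ) ^ 2 / (2 * v)))
      = |x - μ| / s / Real.exp ((x - μ) ^ 2 / (2 * v)) := by
        rw [neg_div, Real.exp_neg]
        ring
    _ ≤ 1 := (div_le_one (Real.exp_pos _)).2 h_exp

/-- A Gaussian measure gives mass at most `4 * δ` to the interval of radius `δ * |μ|` around `0`,
where `μ` is its mean. -/
lemma gaussianReal_Icc_le (μ : ℝ) {v : NNReal} (hv : v ≠ 0) {δ : ℝ} (hδ : δ ≤ 1 / 2) :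
    gaussianReal μ v (Set.Icc (-(δ * |μ|)) (δ * |μ|)) ≤ ENNReal.ofReal (4 * δ) := by
  rcases eq_or_ne μ 0 with rfl | hμ
  · have := nullSingletonClass_gaussianReal (μ := 0) hv
    simp
  have hμ' : 0 < |μ| := abs_pos.2 hμ
  rw [gaussianReal_apply μ hv]
  calc ∫⁻ x in Set.Icc (-(δ * |μ|)) (δ * |μ|), gaussianPDF μ v x
      ≤ ∫⁻ _ in Set.Icc (-(δ * |μ|)) (δ * |μ|), ENNReal.ofReal (2 / |μ|) := by
        refine setLIntegral_mono measurable_const fun x hx ↦ ENNReal.ofReal_le_ofReal ?_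
        have hx' : |x| ≤ δ * |μ| := abs_le.2 hx
        have hdist : |μ| ≤ 2 * |x - μ| := by
          have h_tri := abs_sub_abs_le_abs_sub μ x
          rw [abs_sub_comm] at h_tri
          nlinarith
        rw [le_div_iff₀ hμ']
        nlinarith [abs_sub_mul_gaussianPDFReal_le_one μ x v, gaussianPDFReal_nonneg μ v x]
    _ = ENNReal.ofReal (4 * δ) := by
        rw [setLIntegral_const, Real.volume_Icc, ← ENNReal.ofReal_mul (by positivity)]
        congr 1
        field_simp
        ring

theorem statement2 (α : ℝ) (hα : 0 < α) (hα' : α < 1 / 2) :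
    ∃ c : ℝ, 1 < c ∧ ∀ μ σ : ℝ, 0 < σ →
      1 - α ≤ ((normalMeasure μ σ) {x : ℝ | x - c * |x| ≤ μ ∧ μ ≤ x + c * |x|}).toReal := by
  refine ⟨1 + 4 / α, by simpa using hα, fun μ σ hσ ↦ ?_⟩
  have hv : Real.toNNReal (σ ^ 2) ≠ 0 := (Real.toNNReal_pos.2 (by positivity)).ne'
  unfold normalMeasure
  set P := gaussianReal μ (Real.toNNReal (σ ^ 2))
  set S := {x : ℝ | x - (1 + 4 / α) * |x| ≤ μ ∧ μ ≤ x + (1 + 4 / α) * |x|}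
  have hsub : Sᶜ ⊆ Set.Icc (-(α / 4 * |μ|)) (α / 4 * |μ|) := by
    intro x hx
    have hlt : (1 + 4 / α) * |x| < |x - μ| := by
      contrapose! hx
      obtain ⟨h₁, h₂⟩ := abs_le.1 hx
      rw [Set.mem_compl_iff, not_not]
      constructor <;> linarith
    have hle : 4 / α * |x| ≤ |μ| := by linarith [abs_sub x μ]
    refine abs_le.1 ?_
    calc |x| = α / 4 * (4 / α * |x|) := by field_simp
      _ ≤ α / 4 * |μ| := by gcongr
  have hcompl : P.real Sᶜ ≤ α := by
    refine ENNReal.toReal_le_of_le_ofReal hα.le ((measure_mono hsub).trans ?_)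
    refine (gaussianReal_Icc_le μ hv (δ := α / 4) (by linarith)).trans_eq ?_
    congr 1
    ring
  have h_union : P.real (S ∪ Sᶜ) ≤ P.real S + P.real Sᶜ := measureReal_union_le S Sᶜ
  rw [Set.union_compl_self, probReal_univ] at h_union
  change 1 - α ≤ P.real S
  linarith
end

section
/- Let c > 1, μ ∈ ℝ, σ > 0 and set λ = μ/σ. The coverage probability P₂(μ,σ,c) = ℙ_{μ,σ}(−c|X| ≤ μ ≤ c|X|) depends on (μ,σ) only through λ, satisfies P₂(μ,σ,c) = P₂(−μ,σ,c), and for λ ≥ 0 it equals Φ((c−1)λ/c) + 1 − Φ((c+1)λ/c). -/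
open MeasureTheory ProbabilityTheory

/-- Coverage probability of the Stein interval `(-c|X|, c|X|)`. -/
noncomputable def coverStein (c μ σ : ℝ) : ℝ :=
  ((normalMeasure μ σ) {x : ℝ | -(c * |x|) ≤ μ ∧ μ ≤ c * |x|}).toReal

lemma normalMeasure_eq_map (μ σ : ℝ) :
    normalMeasure μ σ = (gaussianReal 0 1).map (fun z ↦ μ - σ * z) := by
  have h : (fun z : ℝ ↦ μ - σ * z) = (fun y ↦ μ - y) ∘ (fun z ↦ σ * z) := rfl
  rw [h, ← Measure.map_map (by fun_prop) (by fun_prop), gaussianReal_map_const_mul,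
    gaussianReal_map_const_sub, normalMeasure]
  congr 1
  · simp
  · ext
    simp [sq_nonneg]

lemma coverStein_eq_real_abs_le (c μ σ : ℝ) :
    coverStein c μ σ = (normalMeasure μ σ).real {x | |μ| ≤ c * |x|} := by
  simp only [coverStein, Measure.real, abs_le]

lemma coverStein_eq_gaussianReal (c μ : ℝ) {σ : ℝ} (hσ : 0 < σ) :
    coverStein c μ σ = (gaussianReal 0 1).real {z | |μ / σ| ≤ c * |μ / σ - z|} := by
  rw [coverStein_eq_real_abs_le, normalMeasure_eq_map, map_measureReal_apply (by fun_prop)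
    (measurableSet_le (by fun_prop) (by fun_prop))]
  congr 1
  ext z
  have hz : μ - σ * z = σ * (μ / σ - z) := by field_simp
  simp only [Set.mem_preimage, Set.mem_ofPred_eq]
  rw [hz, abs_mul, abs_div, abs_of_pos hσ, div_le_iff₀ hσ]
  ring_nf

lemma coverStein_neg (c μ σ : ℝ) : coverStein c (-μ) σ = coverStein c μ σ := by
  have hneg : normalMeasure (-μ) σ = (normalMeasure μ σ).map (fun x ↦ -x) :=
    gaussianReal_map_neg.symm
  rw [coverStein_eq_real_abs_le, hneg, map_measureReal_apply (by fun_prop)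
    (measurableSet_le (by fun_prop) (by fun_prop)), coverStein_eq_real_abs_le]
  simp only [Set.preimage_ofPred_eq, abs_neg]

lemma gaussianReal_real_Iic_union_Ici {a b : ℝ} (hab : a ≤ b) :
    (gaussianReal 0 1).real (Set.Iic a ∪ Set.Ici b) = stdNormalCDF a + 1 - stdNormalCDF b := by
  have := nullSingletonClass_gaussianReal (μ := 0) one_ne_zero
  have hae : (Set.Iic a ∪ Set.Ici b : Set ℝ) =ᵐ[gaussianReal 0 1] (Set.Iic a ∪ Set.Ioi b : Set ℝ) :=
    Filter.EventuallyEq.rfl.union Ioi_ae_eq_Ici.symm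
  rw [measureReal_congr hae, measureReal_union (Set.Iic_disjoint_Ioi hab) measurableSet_Ioi,
    ← Set.compl_Iic, probReal_compl_eq_one_sub measurableSet_Iic, ← add_sub_assoc]
  rfl

lemma setOf_abs_le_mul_abs_sub {c l : ℝ} (hc : 0 < c) (hl : 0 ≤ l) :
    {z | |l| ≤ c * |l - z|} = Set.Iic ((c - 1) * l / c) ∪ Set.Ici ((c + 1) * l / c) := by
  ext z
  simp only [Set.mem_ofPred_eq, Set.mem_union, Set.mem_Iic, Set.mem_Ici]
  rw [abs_of_nonneg hl, ← div_le_iff₀' hc, le_abs, le_div_iff₀ hc, div_le_iff₀ hc,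
    div_le_iff₀ hc, div_le_iff₀ hc]
  constructor <;> (rintro (h | h); exacts [.inl (by linarith), .inr (by linarith)])

theorem statement3 (c : ℝ) (hc : 1 < c) :
    (∀ μ₁ σ₁ μ₂ σ₂ : ℝ, 0 < σ₁ → 0 < σ₂ → μ₁ / σ₁ = μ₂ / σ₂ →
      coverStein c μ₁ σ₁ = coverStein c μ₂ σ₂) ∧
    (∀ μ σ : ℝ, 0 < σ → coverStein c μ σ = coverStein c (-μ) σ) ∧
    (∀ μ σ : ℝ, 0 < σ → 0 ≤ μ / σ →
      coverStein c μ σ =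
        stdNormalCDF ((c - 1) * (μ / σ) / c) + 1 - stdNormalCDF ((c + 1) * (μ / σ) / c)) := by
  refine ⟨fun μ₁ σ₁ μ₂ σ₂ h₁ h₂ h ↦ ?_, fun μ σ _ ↦ (coverStein_neg c μ σ).symm,
    fun μ σ hσ hl ↦ ?_⟩
  · rw [coverStein_eq_gaussianReal c μ₁ h₁, coverStein_eq_gaussianReal c μ₂ h₂, h]
  · have hc0 : 0 < c := by linarith
    rw [coverStein_eq_gaussianReal c μ hσ, setOf_abs_le_mul_abs_sub hc0 hl,
      gaussianReal_real_Iic_union_Ici (by gcongr; linarith)]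
end

section
/- Fix c > 1 and define P₂(λ, c) = Φ((c−1)λ/c) + 1 − Φ((c+1)λ/c) for λ ≥ 0. Then the function λ ↦ P₂(λ, c) attains its minimum over [0,∞) at the point λ*(c) = √((c/2) · log((c+1)/(c−1))), i.e. P₂(λ*(c), c) ≤ P₂(λ, c) for all λ ≥ 0. -/
open MeasureTheory ProbabilityTheory

theorem mul_gaussianPDFReal_le_iff_s4 {a b l : ℝ} (ha : 0 < a) (hb : 0 < b) :
    a * gaussianPDFReal 0 1 (a * l) ≤ b * gaussianPDFReal 0 1 (b * l) ↔
      (b ^ 2 - a ^ 2) * l ^ 2 / 2 ≤ Real.log (b / a) := by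
  have hK : 0 < (√(2 * Real.pi))⁻¹ := by positivity
  have hform (t : ℝ) (ht : 0 < t) : t * gaussianPDFReal 0 1 (t * l) =
      (√(2 * Real.pi))⁻¹ * Real.exp (Real.log t - (t * l) ^ 2 / 2) := by
    rw [sub_eq_add_neg, Real.exp_add, Real.exp_log ht]
    simp only [gaussianPDFReal, NNReal.coe_one, mul_one, sub_zero, neg_div]
    ring
  rw [hform a ha, hform b hb, mul_le_mul_iff_right₀ hK, Real.exp_le_exp,
    Real.log_div hb.ne' ha.ne']
  constructor <;> intro h <;> linarith

theorem statement4 (c : ℝ) (hc : 1 < c) :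
    let P₂ : ℝ → ℝ := fun l =>
      stdNormalCDF ((c - 1) * l / c) + 1 - stdNormalCDF ((c + 1) * l / c)
    let lstar : ℝ := Real.sqrt (c / 2 * Real.log ((c + 1) / (c - 1)))
    0 ≤ lstar ∧ ∀ l : ℝ, 0 ≤ l → P₂ lstar ≤ P₂ l := by
  intro P₂ lstar
  have hc0 : 0 < c := by linarith
  have hc1 : 0 < c - 1 := by linarith
  have hs0 : 0 ≤ lstar := Real.sqrt_nonneg _
  have hs : lstar ^ 2 = c / 2 * Real.log ((c + 1) / (c - 1)) := by
    refine Real.sq_sqrt (mul_nonneg (by positivity) (Real.log_nonneg ?_))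
    rw [le_div_iff₀ hc1]
    linarith
  set a := (c - 1) / c with ha_def
  set b := (c + 1) / c with hb_def
  have ha : 0 < a := by positivity
  have hb : 0 < b := by positivity
  have hP : P₂ = fun l ↦ stdNormalCDF (a * l) + 1 - stdNormalCDF (b * l) := by
    funext l
    simp only [P₂, a, b, div_mul_eq_mul_div]
  have hderiv (l : ℝ) : HasDerivAt P₂
      (a * gaussianPDFReal 0 1 (a * l) - b * gaussianPDFReal 0 1 (b * l)) l := by
    have hscale (t : ℝ) : HasDerivAt (fun l ↦ stdNormalCDF (t * l))
        (t * gaussianPDFReal 0 1 (t * l)) l := by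
      have := (hasDerivAt_stdNormalCDF (t * l)).comp l ((hasDerivAt_id l).const_mul t)
      simpa [Function.comp_def, mul_comm] using this
    rw [hP]
    exact ((hscale a).add_const 1).sub (hscale b)
  have hsign (l : ℝ) : a * gaussianPDFReal 0 1 (a * l) ≤ b * gaussianPDFReal 0 1 (b * l) ↔
      l ^ 2 ≤ lstar ^ 2 := by
    have hab : b ^ 2 - a ^ 2 = 4 / c := by
      rw [ha_def, hb_def]
      field_simp
      ring
    have hdiv : b / a = (c + 1) / (c - 1) := div_div_div_cancel_right₀ hc0.ne' _ _
    have hl : (4 / c) * l ^ 2 / 2 = l ^ 2 / (c / 2) := by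
      field_simp
      ring
    rw [mul_gaussianPDFReal_le_iff_s4 ha hb, hab, hdiv, hs, hl, div_le_iff₀' (by positivity)]
  have hcont : Continuous P₂ :=
    continuous_iff_continuousAt.2 fun l ↦ (hderiv l).continuousAt
  have hdiff : Differentiable ℝ P₂ := fun l ↦ (hderiv l).differentiableAt
  refine ⟨hs0, fun l hl ↦ ?_⟩
  rcases le_total l lstar with h | h
  · have hanti : AntitoneOn P₂ (Set.Icc 0 lstar) := by
      refine antitoneOn_of_deriv_nonpos (convex_Icc _ _) hcont.continuousOn
        hdiff.differentiableOn fun x hx ↦ ?_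
      rw [interior_Icc] at hx
      rw [(hderiv x).deriv, sub_nonpos, hsign]
      exact pow_le_pow_left₀ hx.1.le hx.2.le 2
    exact hanti ⟨hl, h⟩ ⟨hs0, le_rfl⟩ h
  · have hmono : MonotoneOn P₂ (Set.Ici lstar) := by
      refine monotoneOn_of_deriv_nonneg (convex_Ici _) hcont.continuousOn
        hdiff.differentiableOn fun x hx ↦ ?_
      rw [interior_Ici] at hx
      rw [(hderiv x).deriv, sub_nonneg]
      refine (lt_of_not_ge fun hle ↦ ?_).le
      exact (pow_lt_pow_left₀ hx hs0 two_ne_zero).not_ge ((hsign x).1 hle)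
    exact hmono Set.self_mem_Ici h h
end

section
/- For every c > 1, the infimum over μ ∈ ℝ and σ > 0 of the coverage probability ℙ_{μ,σ}(X − c|X| ≤ μ ≤ X + c|X|) of the Abbott–Rosenblatt interval equals the infimum over μ ∈ ℝ and σ > 0 of the coverage probability ℙ_{μ,σ}(−c|X| ≤ μ ≤ c|X|) of the Stein interval. -/
open MeasureTheory ProbabilityTheory

/-- A normal probability is a centred normal probability of the translated event. -/
theorem normalMeasure_apply (μ σ : ℝ) {s : Set ℝ} (hs : MeasurableSet s) :
    normalMeasure μ σ s = normalMeasure 0 σ {z : ℝ | z + μ ∈ s} := by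
  have h := gaussianReal_map_add_const (μ := 0) (v := Real.toNNReal (σ ^ 2)) μ
  rw [zero_add] at h
  rw [normalMeasure, ← h, Measure.map_apply (measurable_add_const μ) hs]
  rfl

theorem coverAR_eq_centred (c μ σ : ℝ) :
    coverAR c μ σ = (normalMeasure 0 σ {z : ℝ | |z| ≤ c * |z + μ|}).toReal := by
  rw [coverAR, normalMeasure_apply]
  · congr 2
    ext z
    simp only [Set.mem_ofPred_eq, abs_le]
    constructor <;> rintro ⟨h₁, h₂⟩ <;> constructor <;> linarith
  · exact (MeasurableSet.inter
      (measurableSet_le (f := fun x : ℝ => x - c * |x|) (g := fun _ => μ) (by fun_prop) (by fun_prop))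
      (measurableSet_le (f := fun _ : ℝ => μ) (g := fun x => x + c * |x|) (by fun_prop) (by fun_prop)))

theorem coverStein_eq_centred (c μ σ : ℝ) :
    coverStein c μ σ = (normalMeasure 0 σ {z : ℝ | |μ| ≤ c * |z + μ|}).toReal := by
  rw [coverStein, normalMeasure_apply]
  · simp only [Set.mem_ofPred_eq, abs_le]
  · exact (MeasurableSet.inter
      (measurableSet_le (f := fun x : ℝ => -(c * |x|)) (g := fun _ => μ) (by fun_prop) (by fun_prop))
      (measurableSet_le (f := fun _ : ℝ => μ) (g := fun x => c * |x|) (by fun_prop) (by fun_prop)))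

theorem abs_le_mul_abs_iff_sq {c : ℝ} (hc : 0 ≤ c) (a b : ℝ) :
    |a| ≤ c * |b| ↔ a ^ 2 ≤ c ^ 2 * b ^ 2 := by
  rw [← abs_of_nonneg hc, ← abs_mul, ← sq_le_sq, mul_pow, sq_abs]

/-- Rescaling the mean by `(c² - 1) / c²` turns Stein coverage into Abbott–Rosenblatt coverage. -/
theorem coverAR_rescale_eq_coverStein {c : ℝ} (hc : 1 < c) (μ σ : ℝ) :
    coverAR c ((c ^ 2 - 1) / c ^ 2 * μ) σ = coverStein c μ σ := by
  have hc0 : 0 < c := by linarith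
  have hc2 : 0 < c ^ 2 - 1 := by nlinarith
  rw [coverAR_eq_centred, coverStein_eq_centred]
  congr 2
  ext z
  simp only [Set.mem_ofPred_eq]
  rw [abs_le_mul_abs_iff_sq hc0.le, abs_le_mul_abs_iff_sq hc0.le, ← sub_nonneg,
    ← sub_nonneg (b := μ ^ 2)]
  have key : c ^ 2 * (z + (c ^ 2 - 1) / c ^ 2 * μ) ^ 2 - z ^ 2 =
      (c ^ 2 - 1) / c ^ 2 * (c ^ 2 * (z + μ) ^ 2 - μ ^ 2) := by
    field_simp
    ring
  rw [key]
  exact mul_nonneg_iff_of_pos_left (by positivity)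

theorem statement5 (c : ℝ) (hc : 1 < c) :
    sInf {p : ℝ | ∃ μ σ : ℝ, 0 < σ ∧ p = coverAR c μ σ} =
      sInf {p : ℝ | ∃ μ σ : ℝ, 0 < σ ∧ p = coverStein c μ σ} := by
  congr 1
  ext p
  constructor
  · rintro ⟨μ, σ, hσ, rfl⟩
    have hc0 : c ^ 2 ≠ 0 := by positivity
    have hc2 : c ^ 2 - 1 ≠ 0 := by nlinarith
    refine ⟨c ^ 2 / (c ^ 2 - 1) * μ, σ, hσ, ?_⟩
    rw [← coverAR_rescale_eq_coverStein hc]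
    congr 1
    field_simp
  · rintro ⟨μ, σ, hσ, rfl⟩
    exact ⟨(c ^ 2 - 1) / c ^ 2 * μ, σ, hσ, (coverAR_rescale_eq_coverStein hc μ σ).symm⟩
end

section
/- Let 0 < α < 1 and let c = Φ^{-1}((1+α)/2). Then the infimum over all μ ∈ ℝ and σ > 0 of ℙ_{μ,σ}(σ² ≤ X²/c²) equals 1 − α; in particular, ℙ_{μ,σ}(σ² ≤ X²/c²) ≥ 1 − α for all μ ∈ ℝ and σ > 0, with equality when μ = 0. -/
open MeasureTheory ProbabilityTheory

/-- Moving an interval of fixed length to be centered at the mean maximizes its Gaussian mass. -/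
lemma gaussianReal_Ioo_le_centered (m : ℝ) {v : NNReal} (hv : v ≠ 0) (a r : ℝ) (hr : 0 ≤ r) :
    gaussianReal m v (Set.Ioo (a - r) (a + r)) ≤ gaussianReal m v (Set.Ioo (m - r) (m + r)) := by
  set A := Set.Ioo (a - r) (a + r)
  set B := Set.Ioo (m - r) (m + r)
  have hvol : volume (A \ B) = volume (B \ A) := by
    have hAB : volume A = volume B := by simp only [A, B, Real.volume_Ioo]; ring_nf
    have hfin : volume (A ∩ B) ≠ ⊤ := measure_ne_top_of_subset Set.inter_subset_left (by simp [A])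
    have h1 := measure_inter_add_sdiff (μ := volume) A (measurableSet_Ioo : MeasurableSet B)
    have h2 := measure_inter_add_sdiff (μ := volume) B (measurableSet_Ioo : MeasurableSet A)
    rw [Set.inter_comm B A, ← hAB, ← h1] at h2
    exact ((ENNReal.add_right_inj hfin).1 h2).symm
  have hpdf : ∀ x y : ℝ, |x - m| ≤ |y - m| → gaussianPDF m v y ≤ gaussianPDF m v x := by
    intro x y h
    have hsq := sq_le_sq.2 h
    simp only [gaussianPDF, gaussianPDFReal]
    gcongr
  have hle : gaussianReal m v (A \ B) ≤ gaussianReal m v (B \ A) := by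
    rw [gaussianReal_apply m hv, gaussianReal_apply m hv]
    calc ∫⁻ x in A \ B, gaussianPDF m v x
        ≤ ∫⁻ _ in A \ B, gaussianPDF m v (m + r) := by
          refine setLIntegral_mono measurable_const fun x hx ↦ hpdf _ _ ?_
          rw [add_sub_cancel_left, abs_of_nonneg hr]
          by_contra! h
          rw [abs_lt] at h
          exact hx.2 ⟨by linarith [h.1], by linarith [h.2]⟩
      _ = ∫⁻ _ in B \ A, gaussianPDF m v (m + r) := by
          rw [setLIntegral_const, setLIntegral_const, hvol]
      _ ≤ ∫⁻ x in B \ A, gaussianPDF m v x := by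
          refine setLIntegral_mono (measurable_gaussianPDF m v) fun x hx ↦ hpdf _ _ ?_
          rw [add_sub_cancel_left, abs_of_nonneg hr, abs_le]
          exact ⟨by linarith [hx.1.1], by linarith [hx.1.2]⟩
  rw [← measure_inter_add_sdiff A (measurableSet_Ioo : MeasurableSet B),
    ← measure_inter_add_sdiff B (measurableSet_Ioo : MeasurableSet A), Set.inter_comm B A]
  gcongr

lemma stdNormalCDF_neg (c : ℝ) : stdNormalCDF (-c) = 1 - stdNormalCDF c := by
  have := nullSingletonClass_gaussianReal (μ := 0) (v := 1) one_ne_zero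
  have h : gaussianReal 0 1 (Set.Iic (-c)) = gaussianReal 0 1 (Set.Iic c)ᶜ := by
    conv_lhs => rw [← neg_zero (G := ℝ), ← gaussianReal_map_neg]
    rw [Measure.map_apply measurable_neg measurableSet_Iic, Set.compl_Iic,
      measure_congr (Ioi_ae_eq_Ici (a := c)), Set.neg_preimage, Set.neg_Iic, neg_neg]
  rw [stdNormalCDF, h, ← measureReal_def, probReal_compl_eq_one_sub measurableSet_Iic]
  rfl

lemma gaussianReal_zero_one_Ioo_neg_self (c : ℝ) (hc : 0 ≤ c) :
    (gaussianReal 0 1 (Set.Ioo (-c) c)).toReal = 2 * stdNormalCDF c - 1 := by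
  have := nullSingletonClass_gaussianReal (μ := 0) (v := 1) one_ne_zero
  have h := measureReal_sdiff (μ := gaussianReal 0 1) (Set.Iic_subset_Iic.2 (neg_le_self hc))
    measurableSet_Iic
  rw [Set.Iic_sdiff_Iic] at h
  have h' : (gaussianReal 0 1).real (Set.Ioo (-c) c) = (gaussianReal 0 1).real (Set.Ioc (-c) c) :=
    measureReal_congr Ioo_ae_eq_Ioc
  have h₂ := stdNormalCDF_neg c
  simp only [stdNormalCDF, ← measureReal_def] at h₂ ⊢
  linarith

lemma pos_of_half_lt_stdNormalCDF {c : ℝ} (hc : 1 / 2 < stdNormalCDF c) : 0 < c := by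
  by_contra! h
  have hmono : stdNormalCDF c ≤ stdNormalCDF (-c) :=
    measureReal_mono (Set.Iic_subset_Iic.2 (by linarith))
  rw [stdNormalCDF_neg] at hmono
  linarith

lemma normalMeasure_Ioo_centered (μ c : ℝ) {σ : ℝ} (hσ : 0 < σ) :
    normalMeasure μ σ (Set.Ioo (μ - σ * c) (μ + σ * c)) = gaussianReal 0 1 (Set.Ioo (-c) c) := by
  have h : normalMeasure μ σ = (gaussianReal 0 1).map (fun x ↦ μ + σ * x) := by
    have hcomp : (fun x ↦ μ + σ * x) = (fun x ↦ μ + x) ∘ (fun x ↦ σ * x) := rfl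
    rw [hcomp, ← Measure.map_map (by fun_prop) (by fun_prop), gaussianReal_map_const_mul,
      gaussianReal_map_const_add, normalMeasure]
    congr 1
    · simp
    · ext; simp [sq_nonneg]
  rw [h, Measure.map_apply (by fun_prop) measurableSet_Ioo]
  congr 1
  ext x
  simp only [Set.mem_preimage, Set.mem_Ioo]
  constructor
  · rintro ⟨h₁, h₂⟩
    constructor <;> nlinarith
  · rintro ⟨h₁, h₂⟩
    constructor <;> nlinarith

lemma normalMeasure_sq_le_eq {c : ℝ} (hc : 0 < c) (μ : ℝ) {σ : ℝ} (hσ : 0 < σ) :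
    (normalMeasure μ σ {x : ℝ | σ ^ 2 ≤ x ^ 2 / c ^ 2}).toReal =
      1 - (normalMeasure μ σ (Set.Ioo (0 - σ * c) (0 + σ * c))).toReal := by
  have hset : {x : ℝ | σ ^ 2 ≤ x ^ 2 / c ^ 2} = (Set.Ioo (0 - σ * c) (0 + σ * c))ᶜ := by
    ext x
    rw [Set.mem_ofPred_eq, le_div_iff₀ (by positivity), ← mul_pow, Set.mem_compl_iff, Set.mem_Ioo,
      zero_sub, zero_add, ← abs_lt, not_lt, sq_le_sq, abs_of_pos (mul_pos hσ hc)]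
  have : IsProbabilityMeasure (normalMeasure μ σ) := by unfold normalMeasure; infer_instance
  rw [hset, ← measureReal_def, probReal_compl_eq_one_sub measurableSet_Ioo]
  rfl

theorem statement6 (α : ℝ) (hα : 0 < α) (hα' : α < 1)
    (c : ℝ) (hc : stdNormalCDF c = (1 + α) / 2) :
    sInf {p : ℝ | ∃ μ σ : ℝ, 0 < σ ∧
        p = ((normalMeasure μ σ) {x : ℝ | σ ^ 2 ≤ x ^ 2 / c ^ 2}).toReal} = 1 - α ∧
    (∀ μ σ : ℝ, 0 < σ →
      1 - α ≤ ((normalMeasure μ σ) {x : ℝ | σ ^ 2 ≤ x ^ 2 / c ^ 2}).toReal) ∧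
    (∀ σ : ℝ, 0 < σ →
      ((normalMeasure 0 σ) {x : ℝ | σ ^ 2 ≤ x ^ 2 / c ^ 2}).toReal = 1 - α) := by
  have hc0 : 0 < c := pos_of_half_lt_stdNormalCDF (by rw [hc]; linarith)
  have hcentered : (gaussianReal 0 1 (Set.Ioo (-c) c)).toReal = α := by
    rw [gaussianReal_zero_one_Ioo_neg_self c hc0.le, hc]; ring
  have hlower : ∀ μ σ : ℝ, 0 < σ →
      1 - α ≤ ((normalMeasure μ σ) {x : ℝ | σ ^ 2 ≤ x ^ 2 / c ^ 2}).toReal := by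
    intro μ σ hσ
    rw [normalMeasure_sq_le_eq hc0 μ hσ, ← hcentered, ← normalMeasure_Ioo_centered μ c hσ]
    have hv : Real.toNNReal (σ ^ 2) ≠ 0 := (Real.toNNReal_pos.2 (by positivity)).ne'
    exact sub_le_sub_left (ENNReal.toReal_mono (measure_ne_top (gaussianReal μ _) _)
      (gaussianReal_Ioo_le_centered μ hv 0 (σ * c) (by positivity))) _
  have heq : ∀ σ : ℝ, 0 < σ →
      ((normalMeasure 0 σ) {x : ℝ | σ ^ 2 ≤ x ^ 2 / c ^ 2}).toReal = 1 - α := by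
    intro σ hσ
    rw [normalMeasure_sq_le_eq hc0 0 hσ, normalMeasure_Ioo_centered 0 c hσ, hcentered]
  refine ⟨IsLeast.csInf_eq ⟨⟨0, 1, one_pos, (heq 1 one_pos).symm⟩, ?_⟩, hlower, heq⟩
  rintro p ⟨μ, σ, hσ, rfl⟩
  exact hlower μ σ hσ
end

section
/- For every μ ∈ ℝ, σ > 0 and c > 0, ℙ_{μ,σ}(|X| ≥ cσ) ≥ 2(1 − Φ(c)); that is, the probability that a N(μ,σ²) random variable exceeds cσ in absolute value is minimized (over μ) at μ = 0, where it equals the probability that a standard normal exceeds c in absolute value. -/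
open MeasureTheory ProbabilityTheory

open scoped ENNReal NNReal in
lemma measure_le_of_density_threshold {α : Type*} [MeasurableSpace α] {ν : Measure α}
    {f : α → ℝ≥0∞} {A B : Set α} {t : ℝ≥0∞} (hA : MeasurableSet A) (hB : MeasurableSet B)
    (hfin : ν A ≠ ∞) (hAB : ν B = ν A) (hfA : ∀ x ∈ A, t ≤ f x) (hfAc : ∀ x ∉ A, f x ≤ t) :
    ν.withDensity f B ≤ ν.withDensity f A := by
  have hdiff : ν (B \ A) = ν (A \ B) := by
    have h₁ := measure_inter_add_sdiff (μ := ν) A hB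
    have h₂ := measure_inter_add_sdiff (μ := ν) B hA
    rw [Set.inter_comm, hAB, ← h₁] at h₂
    exact (ENNReal.add_right_inj (measure_ne_top_of_subset Set.inter_subset_left hfin)).1 h₂
  have hle : ν.withDensity f (B \ A) ≤ ν.withDensity f (A \ B) := by
    rw [withDensity_apply _ (hB.diff hA), withDensity_apply _ (hA.diff hB)]
    calc ∫⁻ x in B \ A, f x ∂ν ≤ ∫⁻ _ in B \ A, t ∂ν :=
          setLIntegral_mono' (hB.diff hA) fun x hx ↦ hfAc x hx.2
      _ = ∫⁻ _ in A \ B, t ∂ν := by simp [hdiff]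
      _ ≤ ∫⁻ x in A \ B, f x ∂ν := setLIntegral_mono' (hA.diff hB) fun x hx ↦ hfA x hx.1
  rw [← measure_inter_add_sdiff B hA, ← measure_inter_add_sdiff A hB, Set.inter_comm]
  gcongr

open scoped NNReal in
lemma gaussianReal_Ioo_neg_le (μ : ℝ) {v : ℝ≥0} (hv : v ≠ 0) {a : ℝ} (ha : 0 ≤ a) :
    gaussianReal μ v (Set.Ioo (-a) a) ≤ gaussianReal 0 v (Set.Ioo (-a) a) := by
  have hshift : gaussianReal μ v (Set.Ioo (-a) a) =
      gaussianReal 0 v (Set.Ioo (-a - μ) (a - μ)) := by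
    have h := gaussianReal_map_add_const (μ := 0) (v := v) μ
    rw [zero_add] at h
    rw [← h, Measure.map_apply (by fun_prop) measurableSet_Ioo, Set.preimage_add_const_Ioo]
  have hpdf : ∀ x y : ℝ, |x| ≤ |y| → gaussianPDF 0 v y ≤ gaussianPDF 0 v x := by
    intro x y hxy
    have := sq_le_sq.2 hxy
    simp only [gaussianPDF, gaussianPDFReal, sub_zero]
    gcongr
  rw [hshift, gaussianReal_of_var_ne_zero _ hv]
  refine measure_le_of_density_threshold (t := gaussianPDF 0 v a)
    measurableSet_Ioo measurableSet_Ioo (by simp) ?_ ?_ ?_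
  · simp only [Real.volume_Ioo]
    congr 1
    ring
  · intro x hx
    exact hpdf _ _ ((abs_lt.2 hx).le.trans (le_abs_self a))
  · intro x hx
    refine hpdf _ _ ?_
    rw [abs_of_nonneg ha]
    exact not_lt.1 fun h ↦ hx (abs_lt.1 h)

lemma gaussianReal_zero_one_le_abs {c : ℝ} (hc : 0 < c) :
    (gaussianReal 0 1).real {x : ℝ | c ≤ |x|} = 2 * (1 - stdNormalCDF c) := by
  have := nullSingletonClass_gaussianReal (μ := 0) (v := 1) one_ne_zero
  have hset : {x : ℝ | c ≤ |x|} = Set.Ici c ∪ Set.Iic (-c) := by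
    ext x
    simp [le_abs, le_neg]
  have hneg : (gaussianReal 0 1).real (Set.Iic (-c)) = (gaussianReal 0 1).real (Set.Ici c) := by
    have h := gaussianReal_map_neg (μ := 0) (v := 1)
    rw [neg_zero] at h
    conv_lhs => rw [← h]
    rw [map_measureReal_apply (by fun_prop) measurableSet_Iic]
    congr 1
    ext x
    simp
  have hIci : (gaussianReal 0 1).real (Set.Ici c) = 1 - stdNormalCDF c := by
    rw [← measureReal_congr Ioi_ae_eq_Ici, ← Set.compl_Iic,
      probReal_compl_eq_one_sub measurableSet_Iic]
    rfl
  rw [hset, measureReal_union ?_ measurableSet_Iic, hneg, hIci, two_mul]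
  rw [Set.disjoint_left]
  intro x hx hx'
  simp only [Set.mem_Ici, Set.mem_Iic] at hx hx'
  linarith

lemma normalMeasure_zero_le_abs {σ c : ℝ} (hσ : 0 < σ) (hc : 0 < c) :
    (normalMeasure 0 σ).real {x : ℝ | c * σ ≤ |x|} = 2 * (1 - stdNormalCDF c) := by
  have hmap : normalMeasure 0 σ = (gaussianReal 0 1).map (fun x ↦ σ * x) := by
    rw [gaussianReal_map_const_mul, normalMeasure, mul_zero, mul_one,
      Real.toNNReal_of_nonneg (sq_nonneg σ)]
  rw [hmap, map_measureReal_apply (by fun_prop) (measurableSet_le (by fun_prop) (by fun_prop)),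
    ← gaussianReal_zero_one_le_abs hc]
  congr 1
  ext x
  simp [abs_mul, abs_of_pos hσ, mul_comm c, hσ]

theorem statement7 (μ σ c : ℝ) (hσ : 0 < σ) (hc : 0 < c) :
    2 * (1 - stdNormalCDF c) ≤ ((normalMeasure μ σ) {x : ℝ | c * σ ≤ |x|}).toReal ∧
    ((normalMeasure 0 σ) {x : ℝ | c * σ ≤ |x|}).toReal = 2 * (1 - stdNormalCDF c) := by
  refine ⟨?_, normalMeasure_zero_le_abs hσ hc⟩
  have hv : Real.toNNReal (σ ^ 2) ≠ 0 := (Real.toNNReal_pos.2 (by positivity)).ne'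
  have hset : {x : ℝ | c * σ ≤ |x|} = (Set.Ioo (-(c * σ)) (c * σ))ᶜ := by
    ext x
    simp [-Set.mem_Ioo, Set.mem_Ioo.trans abs_lt.symm]
  rw [← normalMeasure_zero_le_abs hσ hc, ← measureReal_def, hset, normalMeasure, normalMeasure,
    probReal_compl_eq_one_sub measurableSet_Ioo, probReal_compl_eq_one_sub measurableSet_Ioo]
  gcongr
  exact ENNReal.toReal_mono (measure_ne_top _ _)
    (gaussianReal_Ioo_neg_le μ hv (mul_pos hc hσ).le)
end

section
/- Suppose in addition that f₀ is even (f₀(−z) = f₀(z) for all z ∈ ℝ) and strictly decreasing on [0,∞). Let 0 < α < 1 and let c > 0 satisfy ∫₀^c f₀(z) dz = α/2. Then for all μ ∈ ℝ and σ > 0, ℙ_{μ,σ}(σ ≤ |X|/c) ≥ 1 − α, and the infimum over all μ ∈ ℝ and σ > 0 of ℙ_{μ,σ}(σ ≤ |X|/c) equals 1 − α (the value 1 − α being attained at μ = 0). -/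
open MeasureTheory

/-- The location-scale family measure with density `x ↦ (1/σ) f₀((x-μ)/σ)` w.r.t. Lebesgue. -/
noncomputable def locScale (f₀ : ℝ → ℝ) (μ σ : ℝ) : Measure ℝ :=
  volume.withDensity fun x => ENNReal.ofReal ((1 / σ) * f₀ ((x - μ) / σ))

/-- An even function that is antitone on `[0, ∞)` is antitone in `|x|`. -/
theorem le_of_abs_le_of_even {f : ℝ → ℝ} (heven : ∀ z, f (-z) = f z)
    (hanti : AntitoneOn f (Set.Ici 0)) {a b : ℝ} (h : |a| ≤ |b|) : f b ≤ f a := by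
  have key : ∀ z, f |z| = f z := fun z => by
    rcases abs_choice z with hz | hz <;> simp [hz, heven]
  rw [← key a, ← key b]
  exact hanti (abs_nonneg a) (abs_nonneg b) h

/-- Among the translates of a symmetric interval, the centered one carries the largest integral of
an even function that is antitone on `[0, ∞)`; here for translations to the right. -/
theorem integral_translate_le_of_nonneg {f : ℝ → ℝ} (hf : Integrable f)
    (heven : ∀ z, f (-z) = f z) (hanti : AntitoneOn f (Set.Ici 0)) {c m : ℝ} (hc : 0 ≤ c)
    (hm : 0 ≤ m) : ∫ z in (m - c)..(m + c), f z ≤ ∫ z in (-c)..c, f z := by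
  have hi : ∀ a b, IntervalIntegrable f volume a b := fun a b => hf.intervalIntegrable
  have hleft := intervalIntegral.integral_add_adjacent_intervals (hi (-c) (m - c)) (hi (m - c) c)
  have hright := intervalIntegral.integral_add_adjacent_intervals (hi (m - c) c) (hi c (m + c))
  have htails : ∫ z in c..(m + c), f z ≤ ∫ z in (-c)..(m - c), f z := by
    have h₁ : ∫ t in (0 : ℝ)..m, f (t + c) = ∫ z in c..(m + c), f z := by
      simp [intervalIntegral.integral_comp_add_right]
    have h₂ : ∫ t in (0 : ℝ)..m, f (t - c) = ∫ z in (-c)..(m - c), f z := by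
      simp [intervalIntegral.integral_comp_sub_right]
    rw [← h₁, ← h₂]
    refine intervalIntegral.integral_mono_on hm (hf.comp_add_right c).intervalIntegrable
      (hf.comp_sub_right c).intervalIntegrable fun t ht => ?_
    refine le_of_abs_le_of_even heven hanti ?_
    rw [abs_of_nonneg (add_nonneg ht.1 hc), abs_le]
    constructor <;> linarith [ht.1]
  linarith

/-- Among the translates of a symmetric interval, the centered one carries the largest integral of
an even function that is antitone on `[0, ∞)`. -/
theorem integral_translate_le {f : ℝ → ℝ} (hf : Integrable f)
    (heven : ∀ z, f (-z) = f z) (hanti : AntitoneOn f (Set.Ici 0)) {c : ℝ} (hc : 0 ≤ c)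
    (m : ℝ) : ∫ z in (m - c)..(m + c), f z ≤ ∫ z in (-c)..c, f z := by
  rcases le_total 0 m with hm | hm
  · exact integral_translate_le_of_nonneg hf heven hanti hc hm
  · have hreflect : ∫ z in (m - c)..(m + c), f z = ∫ z in (-m - c)..(-m + c), f z := by
      have h := intervalIntegral.integral_comp_neg f (a := m - c) (b := m + c)
      simp only [heven] at h
      rw [h]
      congr 1 <;> ring
    rw [hreflect]
    exact integral_translate_le_of_nonneg hf heven hanti hc (neg_nonneg.2 hm)

/-- The integral of an even function over a symmetric interval is twice that over its right half. -/
theorem integral_symm_eq_two_mul_of_even {f : ℝ → ℝ} (hf : Integrable f)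
    (heven : ∀ z, f (-z) = f z) (c : ℝ) :
    ∫ z in (-c)..c, f z = 2 * ∫ z in (0 : ℝ)..c, f z := by
  have hleft : ∫ z in (-c)..0, f z = ∫ z in (0 : ℝ)..c, f z := by
    simpa [heven] using (intervalIntegral.integral_comp_neg f (a := 0) (b := c)).symm
  rw [← intervalIntegral.integral_add_adjacent_intervals (b := 0) hf.intervalIntegrable
    hf.intervalIntegrable, hleft, two_mul]

/-- The probability of `σ ≤ |X| / c` in a location-scale family, in terms of the base density. -/
theorem locScale_setOf_le_abs_div {f₀ : ℝ → ℝ} (hnonneg : ∀ z, 0 ≤ f₀ z)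
    (hprob : ∫ z, f₀ z = 1) {c : ℝ} (hc : 0 < c) (μ : ℝ) {σ : ℝ} (hσ : 0 < σ) :
    ((locScale f₀ μ σ) {x : ℝ | σ ≤ |x| / c}).toReal =
      1 - ∫ z in (-(μ / σ) - c)..(-(μ / σ) + c), f₀ z := by
  have hf : Integrable f₀ := .of_integral_ne_zero (by simp [hprob])
  have hint : Integrable fun x => σ⁻¹ * f₀ (x / σ - μ / σ) :=
    ((hf.comp_sub_right (μ / σ)).comp_div hσ.ne').const_mul _
  have htotal : ∫ x, σ⁻¹ * f₀ (x / σ - μ / σ) = 1 := by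
    rw [integral_const_mul, Measure.integral_comp_div (fun y => f₀ (y - μ / σ)) σ,
      integral_sub_right_eq_self, hprob, abs_of_pos hσ, smul_eq_mul, mul_one,
      inv_mul_cancel₀ hσ.ne']
  have hset : MeasurableSet {x : ℝ | σ ≤ |x| / c} :=
    measurableSet_le measurable_const (by fun_prop)
  have hcompl : {x : ℝ | σ ≤ |x| / c}ᶜ = Set.Ioo (-(σ * c)) (σ * c) := by
    ext x
    simp [le_div_iff₀ hc, abs_lt]
  have hinterval : ∫ x in {x : ℝ | σ ≤ |x| / c}ᶜ, σ⁻¹ * f₀ (x / σ - μ / σ) =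
      ∫ z in (-(μ / σ) - c)..(-(μ / σ) + c), f₀ z := by
    have hle : -(σ * c) ≤ σ * c := by nlinarith [mul_pos hσ hc]
    rw [hcompl, ← integral_Ioc_eq_integral_Ioo, ← intervalIntegral.integral_of_le hle,
      intervalIntegral.integral_const_mul, intervalIntegral.inv_mul_integral_comp_div_sub]
    congr 1 <;> field_simp <;> ring
  rw [← hinterval, ← htotal, ← integral_add_compl hset hint, add_sub_cancel_right, locScale,
    withDensity_apply _ hset, integral_eq_lintegral_of_nonneg_ae
      (.of_forall fun x => mul_nonneg (inv_nonneg.2 hσ.le) (hnonneg _))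
      hint.aestronglyMeasurable.restrict]
  simp only [one_div, sub_div]

theorem statement8 (f₀ : ℝ → ℝ) (hmeas : Measurable f₀) (hnonneg : ∀ z, 0 ≤ f₀ z)
    (hprob : ∫ z, f₀ z = 1) (heven : ∀ z, f₀ (-z) = f₀ z)
    (hdec : StrictAntiOn f₀ (Set.Ici 0))
    (α : ℝ) (hα : 0 < α) (hα' : α < 1)
    (c : ℝ) (hc : 0 < c) (hcα : ∫ z in (0 : ℝ)..c, f₀ z = α / 2) :
    (∀ μ σ : ℝ, 0 < σ →
      1 - α ≤ ((locScale f₀ μ σ) {x : ℝ | σ ≤ |x| / c}).toReal) ∧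
    sInf {p : ℝ | ∃ μ σ : ℝ, 0 < σ ∧
        p = ((locScale f₀ μ σ) {x : ℝ | σ ≤ |x| / c}).toReal} = 1 - α ∧
    (∀ σ : ℝ, 0 < σ →
      ((locScale f₀ 0 σ) {x : ℝ | σ ≤ |x| / c}).toReal = 1 - α) := by
  have hf : Integrable f₀ := .of_integral_ne_zero (by simp [hprob])
  have hcenter : ∫ z in (-c)..c, f₀ z = α := by
    rw [integral_symm_eq_two_mul_of_even hf heven, hcα]
    ring
  have hle : ∀ μ σ : ℝ, 0 < σ →
      1 - α ≤ ((locScale f₀ μ σ) {x : ℝ | σ ≤ |x| / c}).toReal := by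
    intro μ σ hσ
    rw [locScale_setOf_le_abs_div hnonneg hprob hc μ hσ]
    have := integral_translate_le hf heven hdec.antitoneOn hc.le (-(μ / σ))
    linarith
  have heq : ∀ σ : ℝ, 0 < σ →
      ((locScale f₀ 0 σ) {x : ℝ | σ ≤ |x| / c}).toReal = 1 - α := by
    intro σ hσ
    rw [locScale_setOf_le_abs_div hnonneg hprob hc 0 hσ]
    simp [hcenter]
  refine ⟨hle, IsLeast.csInf_eq ⟨⟨0, 1, one_pos, (heq 1 one_pos).symm⟩, ?_⟩, heq⟩
  rintro p ⟨μ, σ, hσ, rfl⟩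
  exact hle μ σ hσ
end

section
/- Suppose in addition that f₀ is continuous and even (f₀(−z) = f₀(z) for all z ∈ ℝ), and let F₀(x) = ∫_{−∞}^{x} f₀(z) dz denote its cumulative distribution function. Then for every μ ≥ 0, σ > 0 and c > 1, setting θ = μ/σ, the coverage probability satisfies ℙ_{μ,σ}(X − c|X| ≤ μ ≤ X + c|X|) = F₀(cθ/(c+1)) + 1 − F₀(cθ/(c−1)). -/
open MeasureTheory

/-- The CDF `F₀` of the density `f₀`. -/
noncomputable def cdfOf (f₀ : ℝ → ℝ) (x : ℝ) : ℝ := ∫ z in Set.Iic x, f₀ z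

/-- Standardization: the probability of the event `(X - μ) / σ ∈ T` under the location-scale
measure is the integral of the base density over `T`. -/
lemma locScale_preimage_toReal {f₀ : ℝ → ℝ} (hmeas : Measurable f₀) (hnonneg : ∀ z, 0 ≤ f₀ z)
    (μ : ℝ) {σ : ℝ} (hσ : 0 < σ) {T : Set ℝ} (hT : MeasurableSet T) :
    ((locScale f₀ μ σ) ((fun x => (x - μ) / σ) ⁻¹' T)).toReal = ∫ z in T, f₀ z := by
  have hstd : Measurable fun x : ℝ => (x - μ) / σ := by fun_prop
  have hpre : MeasurableSet ((fun x : ℝ => (x - μ) / σ) ⁻¹' T) := hstd hT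
  rw [locScale, withDensity_apply _ hpre, ← integral_eq_lintegral_of_nonneg_ae
    (Filter.Eventually.of_forall fun x => mul_nonneg (by positivity) (hnonneg _))
    ((hmeas.comp hstd).const_mul _).aestronglyMeasurable, integral_const_mul,
    ← integral_indicator hpre]
  change 1 / σ * ∫ x, ((fun x => (x - μ) / σ) ⁻¹' T).indicator
    (f₀ ∘ fun x => (x - μ) / σ) x = _
  simp_rw [Set.indicator_comp_right]
  rw [integral_sub_right_eq_self (fun x => T.indicator f₀ (x / σ)) μ,
    Measure.integral_comp_div, integral_indicator hT, abs_of_pos hσ, smul_eq_mul]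
  field_simp

/-- Symmetric tail formula for an even density. -/
lemma setIntegral_Iic_neg_union_Ici_neg {f₀ : ℝ → ℝ} (hprob : ∫ z, f₀ z = 1)
    (heven : ∀ z, f₀ (-z) = f₀ z) {a b : ℝ} (hab : a ≤ b) :
    ∫ z in Set.Iic (-b) ∪ Set.Ici (-a), f₀ z = cdfOf f₀ a + 1 - cdfOf f₀ b := by
  have hint : Integrable f₀ := by
    by_contra h
    rw [integral_undef h] at hprob
    exact zero_ne_one hprob
  have hdisj : AEDisjoint volume (Set.Iic (-b)) (Set.Ici (-a)) := by
    refine measure_mono_null (t := {-a}) ?_ (by simp)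
    rintro z ⟨hz₁, hz₂⟩
    simp only [Set.mem_Iic, Set.mem_Ici, Set.mem_singleton_iff] at *
    linarith
  have hleft := integral_comp_neg_Iic (-b) f₀
  have hright := integral_comp_neg_Iic a f₀
  have htotal := intervalIntegral.integral_Iic_add_Ioi (b := b) (f := f₀) (μ := volume)
    hint.integrableOn hint.integrableOn
  simp only [heven, neg_neg] at hleft hright
  rw [setIntegral_union₀ hdisj measurableSet_Ici.nullMeasurableSet hint.integrableOn
    hint.integrableOn, integral_Ici_eq_integral_Ioi, cdfOf, cdfOf]
  linarith

/-- The interval `x ± c|x|` covers `μ` exactly on two tails of the standardized variable. -/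
lemma coverage_set_eq {μ σ c : ℝ} (hμ : 0 ≤ μ) (hσ : 0 < σ) (hc : 1 < c) :
    {x : ℝ | x - c * |x| ≤ μ ∧ μ ≤ x + c * |x|} =
      (fun x => (x - μ) / σ) ⁻¹'
        (Set.Iic (-(c * (μ / σ) / (c - 1))) ∪ Set.Ici (-(c * (μ / σ) / (c + 1)))) := by
  have hc₁ : 0 < c - 1 := by linarith
  have hc₂ : 0 < c + 1 := by linarith
  have lower (x : ℝ) : (x - μ) / σ ≤ -(c * (μ / σ) / (c - 1)) ↔ (c - 1) * x ≤ -μ := by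
    have h : -(c * (μ / σ) / (c - 1)) = -(c * μ / (c - 1)) / σ := by ring
    rw [h, div_le_div_iff_of_pos_right hσ, ← neg_div, le_div_iff₀ hc₁]
    constructor <;> intro h <;> linarith
  have upper (x : ℝ) : -(c * (μ / σ) / (c + 1)) ≤ (x - μ) / σ ↔ μ ≤ (c + 1) * x := by
    have h : -(c * (μ / σ) / (c + 1)) = -(c * μ / (c + 1)) / σ := by ring
    rw [h, div_le_div_iff_of_pos_right hσ, ← neg_div, div_le_iff₀ hc₂]
    constructor <;> intro h <;> linarith
  ext x
  simp only [Set.mem_ofPred_eq, Set.mem_preimage, Set.mem_union, Set.mem_Iic, Set.mem_Ici,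
    lower, upper]
  rcases le_total 0 x with hx | hx
  · rw [abs_of_nonneg hx]
    have := mul_nonneg hc₁.le hx
    constructor
    · rintro ⟨-, h⟩
      right
      linarith
    · rintro (h | h) <;> constructor <;> nlinarith
  · rw [abs_of_nonpos hx]
    have := mul_nonneg hc₂.le (neg_nonneg.mpr hx)
    constructor
    · rintro ⟨-, h⟩
      left
      linarith
    · rintro (h | h) <;> constructor <;> nlinarith

theorem statement10 (f₀ : ℝ → ℝ) (hmeas : Measurable f₀) (hnonneg : ∀ z, 0 ≤ f₀ z)
    (hprob : ∫ z, f₀ z = 1) (hcont : Continuous f₀) (heven : ∀ z, f₀ (-z) = f₀ z)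
    (μ σ c : ℝ) (hμ : 0 ≤ μ) (hσ : 0 < σ) (hc : 1 < c) :
    ((locScale f₀ μ σ) {x : ℝ | x - c * |x| ≤ μ ∧ μ ≤ x + c * |x|}).toReal =
      cdfOf f₀ (c * (μ / σ) / (c + 1)) + 1 - cdfOf f₀ (c * (μ / σ) / (c - 1)) := by
  have hθ : 0 ≤ c * (μ / σ) := by positivity
  rw [coverage_set_eq hμ hσ hc, locScale_preimage_toReal hmeas hnonneg μ hσ
    (measurableSet_Iic.union measurableSet_Ici)]
  exact setIntegral_Iic_neg_union_Ici_neg hprob heven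
    (div_le_div_of_nonneg_left hθ (by linarith) (by linarith))
end

section
/- Let f₀ : ℝ → (0,∞) be continuous, strictly positive, and even (f₀(−z) = f₀(z) for all z ∈ ℝ). Assume: (a) for all 0 < α₁ < α₂, the function θ ↦ f₀(α₂θ)/f₀(α₁θ) is strictly decreasing on (0,∞) (strict monotone likelihood ratio of the scale family g(θ|α) = α f₀(αθ)); and (b) for all 0 < α₁ < α₂, the function θ ↦ log( f₀(α₁θ)/f₀(α₂θ) ) is convex on (0,∞). Then for every c > 1 there exists a unique θ > 0 satisfying f₀(cθ/(c+1)) / f₀(cθ/(c−1)) = (c+1)/(c−1). -/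
/-- A function that is convex on the positive half-line and increases between two positive points
eventually exceeds every level. -/
theorem ConvexOn.exists_le_of_lt_Ioi {h : ℝ → ℝ} (hconv : ConvexOn ℝ (Set.Ioi 0) h)
    {a b : ℝ} (ha : 0 < a) (hab : a < b) (hlt : h a < h b) (K : ℝ) :
    ∃ x, 0 < x ∧ K ≤ h x := by
  have hd : 0 < (h b - h a) / (b - a) := div_pos (by linarith) (by linarith)
  set d := (h b - h a) / (b - a) with hd_def
  set t := |K - h b| / d + 1 with ht_def
  have ht : 0 < t := by positivity
  have hx : 0 < b + t := by linarith
  refine ⟨b + t, hx, ?_⟩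
  have hslope : d ≤ (h (b + t) - h b) / (b + t - b) :=
    hconv.slope_mono_adjacent ha hx hab (by linarith)
  rw [add_sub_cancel_left, le_div_iff₀ ht] at hslope
  have hdt : d * t = |K - h b| + d := by
    rw [ht_def]
    field_simp
  linarith [le_abs_self (K - h b)]

theorem statement11 (f₀ : ℝ → ℝ) (hcont : Continuous f₀) (hpos : ∀ z, 0 < f₀ z)
    (heven : ∀ z, f₀ (-z) = f₀ z)
    (hMLR : ∀ a₁ a₂ : ℝ, 0 < a₁ → a₁ < a₂ →
      StrictAntiOn (fun θ => f₀ (a₂ * θ) / f₀ (a₁ * θ)) (Set.Ioi 0))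
    (hconv : ∀ a₁ a₂ : ℝ, 0 < a₁ → a₁ < a₂ →
      ConvexOn ℝ (Set.Ioi 0) (fun θ => Real.log (f₀ (a₁ * θ) / f₀ (a₂ * θ))))
    (c : ℝ) (hc : 1 < c) :
    ∃! θ : ℝ, 0 < θ ∧ f₀ (c * θ / (c + 1)) / f₀ (c * θ / (c - 1)) = (c + 1) / (c - 1) := by
  have hc₁ : 0 < c - 1 := by linarith
  have ha₁ : 0 < c / (c + 1) := by positivity
  have ha : c / (c + 1) < c / (c - 1) :=
    div_lt_div_of_pos_left (by linarith) hc₁ (by linarith)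
  simp only [mul_div_right_comm c]
  generalize c / (c + 1) = a₁ at ha₁ ha ⊢
  generalize c / (c - 1) = a₂ at ha ⊢
  have hK : 1 < (c + 1) / (c - 1) := by
    rw [one_lt_div hc₁]
    linarith
  generalize (c + 1) / (c - 1) = K at hK ⊢
  have hmono : StrictMonoOn (fun θ => f₀ (a₁ * θ) / f₀ (a₂ * θ)) (Set.Ioi 0) := by
    intro x hx y hy hxy
    have h := hMLR a₁ a₂ ha₁ ha hx hy hxy
    simpa only [inv_div] using inv_strictAnti₀ (div_pos (hpos _) (hpos _)) h
  have hratio : ∀ θ, 0 < f₀ (a₁ * θ) / f₀ (a₂ * θ) := fun θ => div_pos (hpos _) (hpos _)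
  have hcr : Continuous fun θ => f₀ (a₁ * θ) / f₀ (a₂ * θ) :=
    (hcont.comp (continuous_const_mul a₁)).div (hcont.comp (continuous_const_mul a₂))
      fun θ => (hpos _).ne'
  obtain ⟨x, hx, hKx⟩ := (hconv a₁ a₂ ha₁ ha).exists_le_of_lt_Ioi one_pos one_lt_two
    (Real.log_lt_log (hratio 1)
      (hmono (Set.mem_Ioi.2 one_pos) (Set.mem_Ioi.2 two_pos) one_lt_two)) (Real.log K)
  have hKx' := (Real.log_le_log_iff (by linarith) (hratio x)).1 hKx
  have hzero : f₀ (a₁ * 0) / f₀ (a₂ * 0) = 1 := by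
    simp only [mul_zero]
    exact div_self (hpos 0).ne'
  obtain ⟨θ, hθ, hθK⟩ := intermediate_value_Icc hx.le hcr.continuousOn
    (Set.mem_Icc.2 ⟨hzero.trans_le hK.le, hKx'⟩)
  have hθ₀ : 0 < θ := by
    refine hθ.1.lt_of_ne ?_
    rintro rfl
    exact hK.ne (hzero.symm.trans hθK)
  exact ⟨θ, ⟨hθ₀, hθK⟩, fun y hy => hmono.injOn hy.1 hθ₀ (hy.2.trans hθK.symm)⟩
end

section
/- Let f₀ : ℝ → (0,∞) be continuous, strictly positive, and even. Assume: (a) for all 0 < α₁ < α₂, the function θ ↦ f₀(α₂θ)/f₀(α₁θ) is strictly decreasing on (0,∞); and (b) for all 0 < α₁ < α₂, the function θ ↦ log( f₀(α₁θ)/f₀(α₂θ) ) is convex on (0,∞). Then there exists a continuous function θ̂ : (1,∞) → (0,∞) such that for every c > 1, θ̂(c) is the unique positive solution θ of f₀(cθ/(c+1)) / f₀(cθ/(c−1)) = (c+1)/(c−1). -/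
open Set Filter Topology in
/-- If `F c` is strictly increasing on `(0, ∞)` with zero `θ c`, and `F` is continuous in the
parameter, then the zero depends continuously on the parameter. -/
theorem continuousOn_zero_of_strictMonoOn {X : Type*} [TopologicalSpace X] {s : Set X}
    {F : X → ℝ → ℝ} {θ : X → ℝ} (hs : IsOpen s)
    (hF : ∀ t, ContinuousOn (fun c => F c t) s)
    (hmono : ∀ c ∈ s, StrictMonoOn (F c) (Ioi 0))
    (hθ : ∀ c ∈ s, 0 < θ c) (hzero : ∀ c ∈ s, F c (θ c) = 0) :
    ContinuousOn θ s := by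
  intro c hc
  refine ContinuousAt.continuousWithinAt ?_
  have hs' : s ∈ 𝓝 c := hs.mem_nhds hc
  refine tendsto_order.2 ⟨fun a ha => ?_, fun b hb => ?_⟩
  · obtain ⟨t, ht, htθ⟩ := exists_between (max_lt ha (hθ c hc))
    have ht0 : 0 < t := (le_max_right a 0).trans_lt ht
    have hneg : F c t < 0 := hzero c hc ▸ hmono c hc ht0 (hθ c hc) htθ
    filter_upwards [hs', ((hF t).continuousAt hs').eventually_lt_const hneg] with d hd hdt
    rw [← hzero d hd] at hdt
    exact (le_max_left a 0).trans_lt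
      (ht.trans (((hmono d hd).lt_iff_lt ht0 (hθ d hd)).1 hdt))
  · have hb0 : 0 < b := (hθ c hc).trans hb
    have hbpos : 0 < F c b := hzero c hc ▸ hmono c hc (hθ c hc) hb0 hb
    filter_upwards [hs', ((hF b).continuousAt hs').eventually_const_lt hbpos] with d hd hdb
    rw [← hzero d hd] at hdb
    exact ((hmono d hd).lt_iff_lt (hθ d hd) hb0).1 hdb

open Set in
/-- A strictly increasing convex function on `(0, ∞)` is unbounded above. -/
theorem ConvexOn.exists_le_of_strictMonoOn {g : ℝ → ℝ} (hg : ConvexOn ℝ (Ioi 0) g)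
    (hmono : StrictMonoOn g (Ioi 0)) (L : ℝ) : ∃ M, 0 < M ∧ L ≤ g M := by
  have h12 : g 1 < g 2 := hmono (by simp) (by simp) (by norm_num)
  obtain ⟨n, hn⟩ := exists_nat_gt ((L - g 1) / (g 2 - g 1))
  have hn0 : (0 : ℝ) ≤ n := n.cast_nonneg
  refine ⟨n + 3, by positivity, ?_⟩
  have hslope := hg.secant_mono (a := 1) (x := 2) (y := n + 3) (by simp) (by simp)
    (show (0 : ℝ) < n + 3 by positivity) (by norm_num) (by linarith) (by linarith)
  rw [le_div_iff₀ (by linarith)] at hslope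
  rw [div_lt_iff₀ (by linarith)] at hn
  nlinarith

open Set in
/-- The likelihood ratio `f (a * θ) / f (b * θ)` attains every level above one. -/
theorem exists_ratio_eq {f : ℝ → ℝ} (hcont : Continuous f) (hpos : ∀ z, 0 < f z) {a b k : ℝ}
    (hmono : StrictMonoOn (fun θ => f (a * θ) / f (b * θ)) (Ioi 0))
    (hconv : ConvexOn ℝ (Ioi 0) (fun θ => Real.log (f (a * θ) / f (b * θ)))) (hk : 1 < k) :
    ∃ θ, 0 < θ ∧ f (a * θ) / f (b * θ) = k := by
  have hlog : StrictMonoOn (fun θ => Real.log (f (a * θ) / f (b * θ))) (Ioi 0) :=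
    fun x hx y hy hxy => Real.log_lt_log (div_pos (hpos _) (hpos _)) (hmono hx hy hxy)
  obtain ⟨M, hM, hLM⟩ := hconv.exists_le_of_strictMonoOn hlog (Real.log k)
  have hkM : k ≤ f (a * M) / f (b * M) :=
    (Real.log_le_log_iff (by linarith) (div_pos (hpos _) (hpos _))).1 hLM
  have hc : Continuous (fun θ => f (a * θ) / f (b * θ)) :=
    (hcont.comp (by fun_prop)).div (hcont.comp (by fun_prop)) fun x => (hpos _).ne'
  have h0 : f (a * 0) / f (b * 0) = 1 := by simp [(hpos 0).ne']
  obtain ⟨θ, hθ, hθk⟩ := intermediate_value_Icc hM.le hc.continuousOn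
    (show k ∈ Icc (f (a * 0) / f (b * 0)) (f (a * M) / f (b * M)) from ⟨h0 ▸ hk.le, hkM⟩)
  refine ⟨θ, lt_of_le_of_ne hθ.1 ?_, hθk⟩
  rintro rfl
  exact hk.ne (h0.symm.trans hθk)


theorem statement12 (f₀ : ℝ → ℝ) (hcont : Continuous f₀) (hpos : ∀ z, 0 < f₀ z)
    (heven : ∀ z, f₀ (-z) = f₀ z)
    (hMLR : ∀ a₁ a₂ : ℝ, 0 < a₁ → a₁ < a₂ →
      StrictAntiOn (fun θ => f₀ (a₂ * θ) / f₀ (a₁ * θ)) (Set.Ioi 0))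
    (hconv : ∀ a₁ a₂ : ℝ, 0 < a₁ → a₁ < a₂ →
      ConvexOn ℝ (Set.Ioi 0) (fun θ => Real.log (f₀ (a₁ * θ) / f₀ (a₂ * θ)))) :
    ∃ θhat : ℝ → ℝ, ContinuousOn θhat (Set.Ioi 1) ∧
      ∀ c : ℝ, 1 < c →
        (0 < θhat c ∧
          f₀ (c * θhat c / (c + 1)) / f₀ (c * θhat c / (c - 1)) = (c + 1) / (c - 1)) ∧
        ∀ θ : ℝ, 0 < θ →
          f₀ (c * θ / (c + 1)) / f₀ (c * θ / (c - 1)) = (c + 1) / (c - 1) → θ = θhat c := by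
  have hlt : ∀ c : ℝ, 1 < c → 0 < c / (c + 1) ∧ c / (c + 1) < c / (c - 1) := fun c hc =>
    ⟨by positivity, div_lt_div_of_pos_left (by linarith) (by linarith) (by linarith)⟩
  have hcomm : ∀ c θ d : ℝ, c * θ / d = c / d * θ := fun c θ d => by ring
  simp only [hcomm]
  have hmono : ∀ c : ℝ, 1 < c →
      StrictMonoOn (fun θ => f₀ (c / (c + 1) * θ) / f₀ (c / (c - 1) * θ)) (Set.Ioi 0) := by
    intro c hc x hx y hy hxy
    have h := hMLR _ _ (hlt c hc).1 (hlt c hc).2 hx hy hxy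
    simpa only [inv_div] using inv_strictAnti₀ (div_pos (hpos _) (hpos _)) h
  have hex : ∀ c : ℝ, 1 < c → ∃ θ, 0 < θ ∧
      f₀ (c / (c + 1) * θ) / f₀ (c / (c - 1) * θ) = (c + 1) / (c - 1) := fun c hc =>
    exists_ratio_eq hcont hpos (hmono c hc) (hconv _ _ (hlt c hc).1 (hlt c hc).2)
      ((one_lt_div (by linarith)).2 (by linarith))
  choose! θhat hθpos hθeq using hex
  refine ⟨θhat, ?_, fun c hc => ⟨⟨hθpos c hc, hθeq c hc⟩, fun θ hθ h =>
    (hmono c hc).injOn hθ (hθpos c hc) (h.trans (hθeq c hc).symm)⟩⟩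
  refine continuousOn_zero_of_strictMonoOn
    (F := fun c θ => f₀ (c / (c + 1) * θ) / f₀ (c / (c - 1) * θ) - (c + 1) / (c - 1))
    isOpen_Ioi (fun t => ?_) (fun c hc x hx y hy hxy => sub_lt_sub_right (hmono c hc hx hy hxy) _)
    hθpos fun c hc => sub_eq_zero.2 (hθeq c hc)
  have hadd : ∀ c ∈ Set.Ioi (1 : ℝ), c + 1 ≠ 0 := fun c hc => by
    rw [Set.mem_Ioi] at hc; linarith
  have hsub : ∀ c ∈ Set.Ioi (1 : ℝ), c - 1 ≠ 0 := fun c hc => sub_ne_zero.2 (ne_of_gt hc)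
  have hleft : ContinuousOn (fun c : ℝ => c / (c + 1) * t) (Set.Ioi 1) := by
    fun_prop (disch := assumption)
  have hright : ContinuousOn (fun c : ℝ => c / (c - 1) * t) (Set.Ioi 1) := by
    fun_prop (disch := assumption)
  have hlevel : ContinuousOn (fun c : ℝ => (c + 1) / (c - 1)) (Set.Ioi 1) := by
    fun_prop (disch := assumption)
  exact ((hcont.comp_continuousOn hleft).div (hcont.comp_continuousOn hright)
    fun c _ => (hpos _).ne').sub hlevel
end

section
/- Suppose f₀ is continuous, strictly positive, and even, with cumulative distribution function F₀(x) = ∫_{−∞}^{x} f₀(z) dz, and assume: (a) for all 0 < α₁ < α₂, the function θ ↦ f₀(α₂θ)/f₀(α₁θ) is strictly decreasing on (0,∞); and (b) for all 0 < α₁ < α₂, the function θ ↦ log( f₀(α₁θ)/f₀(α₂θ) ) is convex on (0,∞). Let c > 1 and let θ₀ > 0 be the unique positive solution of f₀(cθ/(c+1)) / f₀(cθ/(c−1)) = (c+1)/(c−1). Then the infimum over all μ ∈ ℝ and σ > 0 of the coverage probability ℙ_{μ,σ}(X − c|X| ≤ μ ≤ X + c|X|) equals ψ(c) = F₀(cθ₀/(c+1))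 + 1 − F₀(cθ₀/(c−1)). -/
open MeasureTheory

lemma setOf_not_cover_of_nonneg {c μ : ℝ} (hc : 1 < c) (hμ : 0 ≤ μ) :
    {x : ℝ | x - c * |x| ≤ μ ∧ μ ≤ x + c * |x|}ᶜ = Set.Ioo (-μ / (c - 1)) (μ / (c + 1)) := by
  ext x
  have h1 : 0 < c - 1 := by linarith
  have h2 : 0 < c + 1 := by linarith
  simp only [Set.mem_compl_iff, Set.mem_ofPred_eq, not_and_or, not_le, Set.mem_Ioo,
    div_lt_iff₀ h1, lt_div_iff₀ h2]
  rcases abs_cases x with ⟨h, hx⟩ | ⟨h, hx⟩ <;> rw [h]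
  · constructor
    · rintro (h | h) <;> constructor <;> nlinarith
    · rintro ⟨h, h'⟩; right; linarith
  · constructor
    · rintro (h | h) <;> constructor <;> nlinarith
    · rintro ⟨h, h'⟩; right; linarith

lemma setOf_not_cover_of_nonpos {c μ : ℝ} (hc : 1 < c) (hμ : μ ≤ 0) :
    {x : ℝ | x - c * |x| ≤ μ ∧ μ ≤ x + c * |x|}ᶜ = Set.Ioo (μ / (c + 1)) (-μ / (c - 1)) := by
  ext x
  have h := Set.ext_iff.1 (setOf_not_cover_of_nonneg (μ := -μ) hc (by linarith)) (-x)
  simp only [Set.mem_compl_iff, Set.mem_ofPred_eq, Set.mem_Ioo, abs_neg, neg_neg, neg_div] at h ⊢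
  have h3 : μ / (c - 1) < -x ∧ -x < -(μ / (c + 1)) ↔ μ / (c + 1) < x ∧ x < -(μ / (c - 1)) := by
    constructor <;> rintro ⟨h, h'⟩ <;> constructor <;> linarith
  rw [← h3, ← h]
  refine not_congr ?_
  constructor <;> rintro ⟨h, h'⟩ <;> constructor <;> linarith

lemma intervalIntegral_locScale_density (f : ℝ → ℝ) (μ : ℝ) {σ : ℝ} (hσ : 0 < σ) (u v : ℝ) :
    ∫ x in u..v, (1 / σ) * f ((x - μ) / σ) = ∫ z in (u - μ) / σ..(v - μ) / σ, f z := by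
  rw [intervalIntegral.integral_const_mul,
    intervalIntegral.integral_comp_sub_right (fun x => f (x / σ)) μ,
    intervalIntegral.integral_comp_div f hσ.ne', smul_eq_mul]
  field_simp

lemma integral_locScale_density {f : ℝ → ℝ} (hprob : ∫ z, f z = 1) (μ : ℝ) {σ : ℝ}
    (hσ : 0 < σ) : ∫ x, (1 / σ) * f ((x - μ) / σ) = 1 := by
  rw [integral_const_mul, integral_sub_right_eq_self (fun x => f (x / σ)) μ,
    Measure.integral_comp_div, hprob, abs_of_pos hσ, smul_eq_mul]
  field_simp

/-- The coverage probability depends on the parameters only through `|μ| / σ`. -/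
lemma locScale_cover_toReal {f : ℝ → ℝ} (hprob : ∫ z, f z = 1)
    (hpos : ∀ z, 0 < f z) (heven : ∀ z, f (-z) = f z) {c : ℝ} (hc : 1 < c) (μ : ℝ) {σ : ℝ}
    (hσ : 0 < σ) :
    ((locScale f μ σ) {x : ℝ | x - c * |x| ≤ μ ∧ μ ≤ x + c * |x|}).toReal =
      1 - ∫ z in c / (c + 1) * (|μ| / σ)..c / (c - 1) * (|μ| / σ), f z := by
  have h1 : 0 < c - 1 := by linarith
  have h2 : 0 < c + 1 := by linarith
  set A := {x : ℝ | x - c * |x| ≤ μ ∧ μ ≤ x + c * |x|} with hA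
  have hAm : MeasurableSet A := by
    have hl : IsClosed {x : ℝ | x - c * |x| ≤ μ} := isClosed_le (by fun_prop) (by fun_prop)
    have hr : IsClosed {x : ℝ | μ ≤ x + c * |x|} := isClosed_le (by fun_prop) (by fun_prop)
    exact (hl.inter hr).measurableSet
  have hnn : ∀ x, 0 ≤ (1 / σ) * f ((x - μ) / σ) := fun x =>
    mul_nonneg (by positivity) (hpos _).le
  have htot := integral_locScale_density hprob μ hσ
  have hint : Integrable fun x => (1 / σ) * f ((x - μ) / σ) :=
    Integrable.of_integral_ne_zero (by rw [htot]; exact one_ne_zero)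
  have hcompl : ((locScale f μ σ) A).toReal = 1 - ∫ x in Aᶜ, (1 / σ) * f ((x - μ) / σ) := by
    rw [locScale, withDensity_apply _ hAm,
      ← integral_eq_lintegral_of_nonneg_ae (Filter.Eventually.of_forall hnn)
        hint.aestronglyMeasurable.restrict]
    exact eq_sub_of_add_eq ((integral_add_compl hAm hint).trans htot)
  rw [hcompl]
  congr 1
  rcases le_total 0 μ with hμ | hμ
  · have hle : -μ / (c - 1) ≤ μ / (c + 1) :=
      (div_nonpos_of_nonpos_of_nonneg (by linarith) h1.le).trans (by positivity)
    rw [hA, setOf_not_cover_of_nonneg hc hμ, ← integral_Ioc_eq_integral_Ioo,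
      ← intervalIntegral.integral_of_le hle, intervalIntegral_locScale_density f μ hσ,
      abs_of_nonneg hμ]
    have hf : f = fun z => f (-z) := funext fun z => (heven z).symm
    conv_lhs => rw [hf]
    rw [intervalIntegral.integral_comp_neg]
    congr 1 <;> field_simp <;> ring
  · have hle : μ / (c + 1) ≤ -μ / (c - 1) :=
      (div_nonpos_of_nonpos_of_nonneg hμ h2.le).trans (div_nonneg (by linarith) h1.le)
    rw [hA, setOf_not_cover_of_nonpos hc hμ, ← integral_Ioc_eq_integral_Ioo,
      ← intervalIntegral.integral_of_le hle, intervalIntegral_locScale_density f μ hσ,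
      abs_of_nonpos hμ]
    congr 1 <;> field_simp <;> ring

lemma hasDerivAt_integral_mul {f : ℝ → ℝ} (hcont : Continuous f) (a b θ : ℝ) :
    HasDerivAt (fun θ => ∫ z in a * θ..b * θ, f z) (b * f (b * θ) - a * f (a * θ)) θ := by
  have key : ∀ k : ℝ, HasDerivAt (fun θ => ∫ z in (0 : ℝ)..k * θ, f z) (k * f (k * θ)) θ := by
    intro k
    have h := (hcont.integral_hasStrictDerivAt 0 (k * θ)).hasDerivAt.comp θ
      ((hasDerivAt_id θ).const_mul k)
    simpa [Function.comp_def, mul_comm] using h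
  refine ((key b).sub (key a)).congr_of_eventuallyEq (Filter.Eventually.of_forall fun t => ?_)
  exact (intervalIntegral.integral_interval_sub_left (hcont.intervalIntegrable _ _)
    (hcont.intervalIntegrable _ _)).symm

/-- Under a strict monotone likelihood ratio, the mass of `[aθ, bθ]` is maximal at the critical
point of `θ`. -/
lemma integral_mul_le_of_root {f : ℝ → ℝ} (hcont : Continuous f) (hpos : ∀ z, 0 < f z)
    {a b θ₀ : ℝ} (hθ₀ : 0 < θ₀)
    (hanti : StrictAntiOn (fun θ => f (b * θ) / f (a * θ)) (Set.Ioi 0))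
    (hb : 0 < b) (hroot : b * f (b * θ₀) = a * f (a * θ₀)) {θ : ℝ} (hθ : 0 ≤ θ) :
    ∫ z in a * θ..b * θ, f z ≤ ∫ z in a * θ₀..b * θ₀, f z := by
  have hd := hasDerivAt_integral_mul hcont a b
  have hc : Continuous fun θ => ∫ z in a * θ..b * θ, f z :=
    continuous_iff_continuousAt.2 fun θ => (hd θ).continuousAt
  have hr₀ : b * (f (b * θ₀) / f (a * θ₀)) = a := by
    rw [← mul_div_assoc, hroot, mul_div_assoc, div_self (hpos _).ne', mul_one]
  have hsplit : ∀ t, b * f (b * t) - a * f (a * t) =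
      (b * (f (b * t) / f (a * t)) - b * (f (b * θ₀) / f (a * θ₀))) * f (a * t) := by
    intro t
    rw [hr₀, sub_mul, mul_assoc b, div_mul_cancel₀ _ (hpos (a * t)).ne']
  rcases le_total θ θ₀ with h | h
  · have hmono : MonotoneOn (fun θ => ∫ z in a * θ..b * θ, f z) (Set.Icc 0 θ₀) := by
      refine monotoneOn_of_deriv_nonneg (convex_Icc _ _) hc.continuousOn
        (fun t _ => (hd t).differentiableAt.differentiableWithinAt) fun t ht => ?_
      rw [interior_Icc] at ht
      rw [(hd t).deriv, hsplit]
      have := hanti (Set.mem_Ioi.2 ht.1) (Set.mem_Ioi.2 hθ₀) ht.2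
      exact mul_nonneg (sub_nonneg.2 (mul_le_mul_of_nonneg_left this.le hb.le)) (hpos _).le
    exact hmono ⟨hθ, h⟩ ⟨hθ₀.le, le_rfl⟩ h
  · have hmono : AntitoneOn (fun θ => ∫ z in a * θ..b * θ, f z) (Set.Ici θ₀) := by
      refine antitoneOn_of_deriv_nonpos (convex_Ici _) hc.continuousOn
        (fun t _ => (hd t).differentiableAt.differentiableWithinAt) fun t ht => ?_
      rw [interior_Ici] at ht
      rw [(hd t).deriv, hsplit]
      have := hanti (Set.mem_Ioi.2 hθ₀) (Set.mem_Ioi.2 (hθ₀.trans ht)) ht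
      exact mul_nonpos_of_nonpos_of_nonneg
        (sub_nonpos.2 (mul_le_mul_of_nonneg_left this.le hb.le)) (hpos _).le
    exact hmono Set.self_mem_Ici h h

theorem statement13 (f₀ : ℝ → ℝ) (hprob : ∫ z, f₀ z = 1)
    (hcont : Continuous f₀) (hpos : ∀ z, 0 < f₀ z) (heven : ∀ z, f₀ (-z) = f₀ z)
    (hMLR : ∀ a₁ a₂ : ℝ, 0 < a₁ → a₁ < a₂ →
      StrictAntiOn (fun θ => f₀ (a₂ * θ) / f₀ (a₁ * θ)) (Set.Ioi 0))
    (hconv : ∀ a₁ a₂ : ℝ, 0 < a₁ → a₁ < a₂ →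
      ConvexOn ℝ (Set.Ioi 0) (fun θ => Real.log (f₀ (a₁ * θ) / f₀ (a₂ * θ))))
    (c : ℝ) (hc : 1 < c) (θ₀ : ℝ) (hθ₀ : 0 < θ₀)
    (hroot : f₀ (c * θ₀ / (c + 1)) / f₀ (c * θ₀ / (c - 1)) = (c + 1) / (c - 1))
    (huniq : ∀ θ : ℝ, 0 < θ →
      f₀ (c * θ / (c + 1)) / f₀ (c * θ / (c - 1)) = (c + 1) / (c - 1) → θ = θ₀) :
    sInf {p : ℝ | ∃ μ σ : ℝ, 0 < σ ∧
        p = ((locScale f₀ μ σ) {x : ℝ | x - c * |x| ≤ μ ∧ μ ≤ x + c * |x|}).toReal} =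
      cdfOf f₀ (c * θ₀ / (c + 1)) + 1 - cdfOf f₀ (c * θ₀ / (c - 1)) := by
  have h1 : 0 < c - 1 := by linarith
  have h2 : 0 < c + 1 := by linarith
  have ha : 0 < c / (c + 1) := by positivity
  have hb : 0 < c / (c - 1) := by positivity
  have hab : c / (c + 1) < c / (c - 1) :=
    div_lt_div_of_pos_left (by linarith) h1 (by linarith)
  have hint : Integrable f₀ := Integrable.of_integral_ne_zero (by rw [hprob]; exact one_ne_zero)
  rw [mul_div_right_comm, mul_div_right_comm] at hroot
  have hcrit : c / (c - 1) * f₀ (c / (c - 1) * θ₀) = c / (c + 1) * f₀ (c / (c + 1) * θ₀) := by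
    rw [div_eq_div_iff (hpos _).ne' h1.ne'] at hroot
    generalize f₀ (c / (c - 1) * θ₀) = u at hroot ⊢
    generalize f₀ (c / (c + 1) * θ₀) = v at hroot ⊢
    rw [div_mul_eq_mul_div, div_mul_eq_mul_div, div_eq_div_iff h1.ne' h2.ne']
    linear_combination -c * hroot
  have hval : cdfOf f₀ (c * θ₀ / (c + 1)) + 1 - cdfOf f₀ (c * θ₀ / (c - 1)) =
      1 - ∫ z in c / (c + 1) * θ₀..c / (c - 1) * θ₀, f₀ z := by
    rw [← intervalIntegral.integral_Iic_sub_Iic hint.integrableOn hint.integrableOn,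
      mul_div_right_comm, mul_div_right_comm]
    simp only [cdfOf]
    ring
  rw [hval]
  refine IsLeast.csInf_eq ⟨⟨θ₀, 1, one_pos, ?_⟩, ?_⟩
  · rw [locScale_cover_toReal hprob hpos heven hc θ₀ one_pos, abs_of_pos hθ₀, div_one]
  · rintro p ⟨μ, σ, hσ, rfl⟩
    rw [locScale_cover_toReal hprob hpos heven hc μ hσ]
    exact sub_le_sub_left (integral_mul_le_of_root hcont hpos hθ₀ (hMLR _ _ ha hab) hb hcrit
      (by positivity)) 1
end

section
/- Suppose f₀ is continuous, strictly positive, and even, with cumulative distribution function F₀, and assume: (a) for all 0 < α₁ < α₂, the function θ ↦ f₀(α₂θ)/f₀(α₁θ) is strictly decreasing on (0,∞); and (b) for all 0 < α₁ < α₂, the function θ ↦ log( f₀(α₁θ)/f₀(α₂θ) ) is convex on (0,∞). Then the function ψ : (1,∞) → ℝ defined by ψ(c) = inf over μ ∈ ℝ and σ > 0 of ℙ_{μ,σ}(X − c|X| ≤ μ ≤ X + c|X|) is continuous on (1,∞). -/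
open MeasureTheory

open Set Filter Topology

/-- A continuous function on `ℝ` with limits at `±∞` is uniformly continuous. -/
lemma uniformContinuous_of_tendsto_atBot_atTop {G : ℝ → ℝ} (hG : Continuous G) {l L : ℝ}
    (hl : Tendsto G atBot (𝓝 l)) (hL : Tendsto G atTop (𝓝 L)) : UniformContinuous G := by
  have hclamp : LipschitzWith 1 (fun u : ℝ => max 0 (min 1 u)) :=
    (LipschitzWith.id.const_min 1).const_max 0
  have hramp : UniformContinuous (fun u : ℝ => l + (L - l) * max 0 (min 1 u)) := by
    have h := (hclamp.uniformContinuous.const_smul (L - l))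
    exact uniformContinuous_const.add h
  have hdiff : UniformContinuous (fun u => G u - (l + (L - l) * max 0 (min 1 u))) := by
    refine Continuous.uniformContinuous_of_tendsto_cocompact (x := 0)
      (hG.sub hramp.continuous) ?_
    rw [cocompact_eq_atBot_atTop, tendsto_sup]
    constructor
    · refine Tendsto.congr' (f₁ := fun u => G u - l) ?_ (by simpa using hl.sub_const l)
      filter_upwards [eventually_le_atBot (0 : ℝ)] with u hu
      rw [max_eq_left ((min_le_right _ _).trans hu)]
      ring
    · refine Tendsto.congr' (f₁ := fun u => G u - L) ?_ (by simpa using hL.sub_const L)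
      filter_upwards [eventually_ge_atTop (1 : ℝ)] with u hu
      rw [min_eq_left hu, max_eq_right zero_le_one]
      ring
  simpa using hdiff.add hramp

/-- If `P` is continuous with a limit at `+∞`, then `P (t * b) → P (t * a)` as `b → a > 0`,
uniformly in `t > 0`. -/
lemma eventually_forall_pos_abs_comp_mul_sub_lt {P : ℝ → ℝ} (hP : Continuous P) {L : ℝ}
    (hL : Tendsto P atTop (𝓝 L)) {a ε : ℝ} (ha : 0 < a) (hε : 0 < ε) :
    ∀ᶠ b in 𝓝 a, ∀ t, 0 < t → |P (t * b) - P (t * a)| < ε := by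
  have hG : UniformContinuous (fun u => P (Real.exp u)) :=
    uniformContinuous_of_tendsto_atBot_atTop (hP.comp Real.continuous_exp)
      ((hP.tendsto 0).comp Real.tendsto_exp_atBot) (hL.comp Real.tendsto_exp_atTop)
  obtain ⟨δ, hδ, h⟩ := Metric.uniformContinuous_iff.1 hG ε hε
  filter_upwards [Metric.tendsto_nhds.1 (Real.continuousAt_log ha.ne').tendsto δ hδ,
    lt_mem_nhds ha] with b hb hb0 t ht
  have key := @h (Real.log t + Real.log b) (Real.log t + Real.log a) (by simpa using hb)
  simpa only [Real.exp_add, Real.exp_log ht, Real.exp_log hb0, Real.exp_log ha,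
    Real.dist_eq] using key

/-- If `P` is continuous with limits at `±∞`, then `P (t * b) → P (t * a)` as `b → a > 0`,
uniformly in `t`. -/
lemma eventually_forall_abs_comp_mul_sub_lt {P : ℝ → ℝ} (hP : Continuous P) {l L : ℝ}
    (hl : Tendsto P atBot (𝓝 l)) (hL : Tendsto P atTop (𝓝 L)) {a ε : ℝ} (ha : 0 < a)
    (hε : 0 < ε) : ∀ᶠ b in 𝓝 a, ∀ t, |P (t * b) - P (t * a)| < ε := by
  filter_upwards [eventually_forall_pos_abs_comp_mul_sub_lt hP hL ha hε,
    eventually_forall_pos_abs_comp_mul_sub_lt (hP.comp continuous_neg)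
      (hl.comp tendsto_neg_atTop_atBot) ha hε] with b hb hb' t
  rcases lt_trichotomy t 0 with ht | rfl | ht
  · simpa using hb' (-t) (by linarith)
  · simpa using hε
  · exact hb t ht

/-- For `c > 1`, the complement of the set of `x` with `|x - μ| ≤ c * |x|` is an interval. -/
lemma compl_setOf_sub_le_and_le_add {c : ℝ} (hc : 1 < c) (μ : ℝ) :
    {x : ℝ | x - c * |x| ≤ μ ∧ μ ≤ x + c * |x|}ᶜ = uIoo (-(μ / (c - 1))) (μ / (c + 1)) := by
  obtain ⟨A, rfl⟩ : ∃ A, μ = A * (c - 1) := ⟨μ / (c - 1), by field_simp [(sub_pos.2 hc).ne']⟩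
  obtain ⟨B, hB⟩ : ∃ B, A * (c - 1) = B * (c + 1) :=
    ⟨A * (c - 1) / (c + 1), by field_simp⟩
  have h1 : A * (c - 1) / (c - 1) = A := mul_div_cancel_right₀ _ (by linarith)
  have h2 : A * (c - 1) / (c + 1) = B := by rw [hB]; exact mul_div_cancel_right₀ _ (by linarith)
  rw [h1, h2]
  have hle : ∀ u : ℝ, 0 ≤ u * (c - 1) ↔ 0 ≤ u := fun u => mul_nonneg_iff_of_pos_right (by linarith)
  have hle' : ∀ u : ℝ, 0 ≤ u * (c + 1) ↔ 0 ≤ u := fun u => mul_nonneg_iff_of_pos_right (by linarith)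
  ext x
  simp only [uIoo, mem_compl_iff, mem_ofPred_eq, mem_Ioo, not_and_or, not_le]
  rcases le_total 0 A with hA | hA
  · have hB0 : 0 ≤ B := by rw [← hle', ← hB, hle]; exact hA
    rw [min_eq_left (by linarith), max_eq_right (by linarith)]
    rcases le_total 0 x with hx | hx
    · rw [abs_of_nonneg hx]
      constructor
      · rintro (h | h)
        · nlinarith
        · have : x < B := by nlinarith
          refine ⟨lt_of_le_of_ne (by linarith) ?_, this⟩
          rintro rfl
          nlinarith
      · rintro ⟨-, h⟩
        right; nlinarith
    · rw [abs_of_nonpos hx]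
      constructor
      · rintro (h | h)
        · nlinarith
        · have : -A < x := by nlinarith
          refine ⟨this, lt_of_le_of_ne (by linarith) ?_⟩
          rintro rfl
          nlinarith
      · rintro ⟨h, -⟩
        right; nlinarith
  · have hB0 : B ≤ 0 := by
      have : 0 ≤ -B := (hle' (-B)).1 (by nlinarith)
      linarith
    rw [min_eq_right (by linarith), max_eq_left (by linarith)]
    rcases le_total 0 x with hx | hx
    · rw [abs_of_nonneg hx]
      constructor
      · rintro (h | h)
        · have : x < -A := by nlinarith
          refine ⟨lt_of_le_of_ne (by linarith) ?_, this⟩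
          rintro rfl
          nlinarith
        · nlinarith
      · rintro ⟨-, h⟩
        left; nlinarith
    · rw [abs_of_nonpos hx]
      constructor
      · rintro (h | h)
        · have : B < x := by nlinarith
          refine ⟨this, lt_of_le_of_ne (by linarith) ?_⟩
          rintro rfl
          nlinarith
        · nlinarith
      · rintro ⟨h, -⟩
        left; nlinarith

/-- The probability of `|X - μ| ≤ c * |X|` in terms of a primitive of the density. -/
lemma locScale_setOf_toReal {f₀ : ℝ → ℝ} (hprob : ∫ z, f₀ z = 1) (hcont : Continuous f₀)
    (hnonneg : ∀ z, 0 ≤ f₀ z) {c μ σ : ℝ} (hc : 1 < c) (hσ : 0 < σ) :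
    ((locScale f₀ μ σ) {x : ℝ | x - c * |x| ≤ μ ∧ μ ≤ x + c * |x|}).toReal =
      1 - |(∫ z in (0)..(-(μ / σ) * (c / (c + 1))), f₀ z) -
        ∫ z in (0)..(-(μ / σ) * (c / (c - 1))), f₀ z| := by
  have hint : Integrable f₀ := by
    by_contra h
    rw [integral_undef h] at hprob
    exact zero_ne_one hprob
  set g : ℝ → ℝ := fun x => (1 / σ) * f₀ ((x - μ) / σ) with hg
  have hg0 : ∀ x, 0 ≤ g x := fun x => mul_nonneg (by positivity) (hnonneg _)
  have hgc : Continuous g := by fun_prop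
  have hgi : Integrable g :=
    (((hint.comp_div hσ.ne').comp_sub_right μ)).const_mul _
  have hg1 : ∫ x, g x = 1 := by
    rw [hg, integral_const_mul, integral_sub_right_eq_self (fun x => f₀ (x / σ)),
      Measure.integral_comp_div, hprob, abs_of_pos hσ, smul_eq_mul, mul_one,
      one_div_mul_cancel hσ.ne']
  set S := {x : ℝ | x - c * |x| ≤ μ ∧ μ ≤ x + c * |x|} with hS
  have hSm : MeasurableSet S :=
    ((isClosed_le (by fun_prop) (by fun_prop)).inter
      (isClosed_le (by fun_prop) (by fun_prop)) :
      IsClosed ({x : ℝ | x - c * |x| ≤ μ} ∩ {x | μ ≤ x + c * |x|})).measurableSet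
  have hreal : ((locScale f₀ μ σ) S).toReal = ∫ x in S, g x := by
    rw [locScale, withDensity_apply _ hSm, integral_eq_lintegral_of_nonneg_ae
      (Eventually.of_forall hg0) hgc.aestronglyMeasurable]
  have hcompl : ∫ x in Sᶜ, g x = |∫ x in (-(μ / (c - 1)))..(μ / (c + 1)), g x| := by
    rw [intervalIntegral.abs_integral_eq_abs_integral_uIoc, hS, compl_setOf_sub_le_and_le_add hc,
      uIoo, uIoc, ← integral_Ioc_eq_integral_Ioo, abs_of_nonneg]
    exact integral_nonneg hg0
  have hsubst : ∫ x in (-(μ / (c - 1)))..(μ / (c + 1)), g x =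
      ∫ z in (-(μ / σ) * (c / (c - 1)))..(-(μ / σ) * (c / (c + 1))), f₀ z := by
    have hc1 : c - 1 ≠ 0 := by linarith
    have hc2 : c + 1 ≠ 0 := by linarith
    have h := intervalIntegral.inv_mul_integral_comp_div_sub (a := -(μ / (c - 1)))
      (b := μ / (c + 1)) (f := f₀) (c := σ) (d := μ / σ)
    rw [hg, intervalIntegral.integral_const_mul, one_div]
    simp only [sub_div]
    rw [h]
    congr 1 <;> field_simp <;> ring
  have hadd := integral_add_compl hSm hgi
  rw [intervalIntegral.integral_interval_sub_left hint.intervalIntegrable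
    hint.intervalIntegrable, ← hsubst, ← hcompl, hreal]
  linarith

/-- Infima over a common parameter set of uniformly close functions are close. -/
lemma sInf_le_sInf_add_of_le {φ φ' : ℝ → ℝ → ℝ} {ε : ℝ} (h0 : ∀ μ σ, 0 ≤ φ μ σ)
    (h : ∀ μ σ, 0 < σ → φ μ σ ≤ φ' μ σ + ε) :
    sInf {p | ∃ μ σ, 0 < σ ∧ p = φ μ σ} ≤ sInf {p | ∃ μ σ, 0 < σ ∧ p = φ' μ σ} + ε := by
  rw [← sub_le_iff_le_add]
  refine le_csInf ⟨φ' 0 1, 0, 1, one_pos, rfl⟩ ?_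
  rintro _ ⟨μ, σ, hσ, rfl⟩
  rw [sub_le_iff_le_add]
  refine le_trans (csInf_le ⟨0, ?_⟩ ⟨μ, σ, hσ, rfl⟩) (h μ σ hσ)
  rintro _ ⟨μ, σ, -, rfl⟩
  exact h0 μ σ

theorem statement14 (f₀ : ℝ → ℝ) (hprob : ∫ z, f₀ z = 1)
    (hcont : Continuous f₀) (hpos : ∀ z, 0 < f₀ z) (heven : ∀ z, f₀ (-z) = f₀ z)
    (hMLR : ∀ a₁ a₂ : ℝ, 0 < a₁ → a₁ < a₂ →
      StrictAntiOn (fun θ => f₀ (a₂ * θ) / f₀ (a₁ * θ)) (Set.Ioi 0))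
    (hconv : ∀ a₁ a₂ : ℝ, 0 < a₁ → a₁ < a₂ →
      ConvexOn ℝ (Set.Ioi 0) (fun θ => Real.log (f₀ (a₁ * θ) / f₀ (a₂ * θ)))) :
    ContinuousOn (fun c : ℝ =>
      sInf {p : ℝ | ∃ μ σ : ℝ, 0 < σ ∧
        p = ((locScale f₀ μ σ) {x : ℝ | x - c * |x| ≤ μ ∧ μ ≤ x + c * |x|}).toReal})
      (Set.Ioi 1) := by
  have hint : Integrable f₀ := by
    by_contra h
    rw [integral_undef h] at hprob
    exact zero_ne_one hprob
  set P : ℝ → ℝ := fun x => ∫ z in (0)..x, f₀ z with hP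
  have hPc : Continuous P := intervalIntegral.continuous_primitive (fun _ _ =>
    hint.intervalIntegrable) 0
  have hPtop : Tendsto P atTop (𝓝 (∫ z in Ioi 0, f₀ z)) :=
    intervalIntegral_tendsto_integral_Ioi 0 hint.integrableOn tendsto_id
  have hPbot : Tendsto P atBot (𝓝 (-∫ z in Iic 0, f₀ z)) := by
    refine (intervalIntegral_tendsto_integral_Iic 0 hint.integrableOn tendsto_id).neg.congr ?_
    exact fun x => (intervalIntegral.integral_symm x 0).symm
  intro c (hc : 1 < c)
  apply ContinuousAt.continuousWithinAt
  have hc1 : c - 1 ≠ 0 := by linarith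
  have hc2 : c + 1 ≠ 0 := by linarith
  have hcont₁ : ContinuousAt (fun c : ℝ => c / (c + 1)) c :=
    continuousAt_id.div (by fun_prop) hc2
  have hcont₂ : ContinuousAt (fun c : ℝ => c / (c - 1)) c :=
    continuousAt_id.div (by fun_prop) hc1
  rw [ContinuousAt, Metric.tendsto_nhds]
  intro ε hε
  filter_upwards [lt_mem_nhds hc,
    hcont₁.eventually (eventually_forall_abs_comp_mul_sub_lt hPc hPbot hPtop
      (div_pos (by linarith) (by linarith)) (by positivity : 0 < ε / 4)),
    hcont₂.eventually (eventually_forall_abs_comp_mul_sub_lt hPc hPbot hPtop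
      (div_pos (by linarith) (by linarith)) (by positivity : 0 < ε / 4))] with d hd h₁ h₂
  have hclose : ∀ μ σ : ℝ, 0 < σ →
      |((locScale f₀ μ σ) {x : ℝ | x - d * |x| ≤ μ ∧ μ ≤ x + d * |x|}).toReal -
        ((locScale f₀ μ σ) {x : ℝ | x - c * |x| ≤ μ ∧ μ ≤ x + c * |x|}).toReal| ≤ ε / 2 := by
    intro μ σ hσ
    rw [locScale_setOf_toReal hprob hcont (fun z => (hpos z).le) hd hσ,
      locScale_setOf_toReal hprob hcont (fun z => (hpos z).le) hc hσ, sub_sub_sub_cancel_left]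
    refine (abs_abs_sub_abs_le _ _).trans ?_
    have e₁ := abs_lt.1 (h₁ (-(μ / σ)))
    have e₂ := abs_lt.1 (h₂ (-(μ / σ)))
    simp only [hP] at e₁ e₂
    rw [abs_le]
    constructor <;> linarith
  rw [Real.dist_eq]
  refine lt_of_le_of_lt (abs_le.2 ⟨?_, ?_⟩) (half_lt_self hε)
  · rw [neg_le_sub_iff_le_add]
    exact sInf_le_sInf_add_of_le (fun _ _ => ENNReal.toReal_nonneg)
      fun μ σ hσ => by linarith [(abs_le.1 (hclose μ σ hσ)).1]
  · rw [sub_le_iff_le_add']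
    exact sInf_le_sInf_add_of_le (fun _ _ => ENNReal.toReal_nonneg)
      fun μ σ hσ => by linarith [(abs_le.1 (hclose μ σ hσ)).2]
end

section
/- For the Cauchy location-scale family, for every α with 0 < α < 1/2 there exists c > 1 such that the infimum over all μ ∈ ℝ and σ > 0 of the coverage probability ℙ_{μ,σ}(X − c|X| ≤ μ ≤ X + c|X|) equals exactly 1 − α. -/
open MeasureTheory

/-- The Cauchy distribution with location `μ` and scale `σ`, given by its density. -/
noncomputable def cauchyMeasure (μ σ : ℝ) : Measure ℝ :=
  volume.withDensity fun x =>
    ENNReal.ofReal ((1 / (Real.pi * σ)) * (1 / (1 + ((x - μ) / σ) ^ 2)))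

lemma isProbabilityMeasure_cauchyMeasure (μ : ℝ) {σ : ℝ} (hσ : 0 < σ) :
    IsProbabilityMeasure (cauchyMeasure μ σ) := by
  lift σ to NNReal using hσ.le
  have hσ' : σ ≠ 0 := fun h => hσ.ne' (congrArg NNReal.toReal h)
  refine ⟨?_⟩
  rw [cauchyMeasure, withDensity_apply _ MeasurableSet.univ, Measure.restrict_univ,
    ← ProbabilityTheory.lintegral_cauchyPDF_eq_one μ hσ']
  refine lintegral_congr fun x => ?_
  rw [ProbabilityTheory.cauchyPDF_def, ProbabilityTheory.cauchyPDFReal_def', one_div, one_div,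
    mul_inv, NNReal.coe_inv]

lemma cauchyMeasure_Ioo (μ : ℝ) {σ : ℝ} (hσ : 0 < σ) {a b : ℝ} (hab : a ≤ b) :
    (cauchyMeasure μ σ (Set.Ioo a b)).toReal =
      (Real.arctan ((b - μ) / σ) - Real.arctan ((a - μ) / σ)) / Real.pi := by
  have hcont : Continuous fun x : ℝ =>
      (1 / (Real.pi * σ)) * (1 / (1 + ((x - μ) / σ) ^ 2)) := by
    refine continuous_const.mul (continuous_const.div (by fun_prop) fun x => ?_)
    positivity
  have hderiv : ∀ x : ℝ, HasDerivAt (fun x => Real.arctan ((x - μ) / σ) / Real.pi)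
      ((1 / (Real.pi * σ)) * (1 / (1 + ((x - μ) / σ) ^ 2))) x := by
    intro x
    refine (((((hasDerivAt_id' x).sub_const μ).div_const σ).arctan).div_const
      Real.pi).congr_deriv ?_
    simp only [one_div, mul_inv]
    ring
  have hint := intervalIntegral.integral_eq_sub_of_hasDerivAt (a := a) (b := b)
    (fun x _ => hderiv x) (hcont.intervalIntegrable a b)
  rw [cauchyMeasure, withDensity_apply _ measurableSet_Ioo, sub_div, ← hint,
    intervalIntegral.integral_of_le hab, integral_Ioc_eq_integral_Ioo,
    integral_eq_lintegral_of_nonneg_ae (.of_forall fun x => by positivity)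
      hcont.aestronglyMeasurable]

lemma setOf_mem_scaled_interval_compl_of_nonneg {c μ : ℝ} (hc : 1 < c) (hμ : 0 ≤ μ) :
    {x : ℝ | x - c * |x| ≤ μ ∧ μ ≤ x + c * |x|}ᶜ = Set.Ioo (-(μ / (c - 1))) (μ / (c + 1)) := by
  ext x
  have h1 : 0 < c - 1 := by linarith
  have h2 : 0 < c + 1 := by linarith
  simp only [Set.mem_compl_iff, Set.mem_ofPred_eq, Set.mem_Ioo, neg_lt,
    lt_div_iff₀ h2, lt_div_iff₀ h1, not_and_or, not_le]
  rcases abs_cases x with ⟨h, hx⟩ | ⟨h, hx⟩ <;> rw [h]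
  · constructor
    · rintro (h | h) <;> constructor <;> nlinarith
    · rintro ⟨-, h⟩; right; linarith
  · constructor
    · rintro (h | h) <;> constructor <;> nlinarith
    · rintro ⟨h, -⟩; right; nlinarith

lemma setOf_mem_scaled_interval_compl_of_nonpos {c μ : ℝ} (hc : 1 < c) (hμ : μ ≤ 0) :
    {x : ℝ | x - c * |x| ≤ μ ∧ μ ≤ x + c * |x|}ᶜ = Set.Ioo (μ / (c + 1)) (-(μ / (c - 1))) := by
  have h := setOf_mem_scaled_interval_compl_of_nonneg hc (neg_nonneg.2 hμ)
  ext x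
  have hx := Set.ext_iff.1 h (-x)
  simp only [Set.mem_compl_iff, Set.mem_ofPred_eq, Set.mem_Ioo, abs_neg, neg_div] at hx ⊢
  constructor
  · intro h'
    have := hx.1 fun h'' => h' ⟨by linarith, by linarith⟩
    constructor <;> linarith
  · intro h' h''
    exact hx.2 ⟨by linarith, by linarith⟩ ⟨by linarith, by linarith⟩

/-- The probability that `X ± c|X|` misses the location parameter. -/
lemma cauchyMeasure_noncoverage (μ : ℝ) {σ c : ℝ} (hσ : 0 < σ) (hc : 1 < c) :
    (cauchyMeasure μ σ {x : ℝ | x - c * |x| ≤ μ ∧ μ ≤ x + c * |x|}ᶜ).toReal =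
      (Real.arctan (|μ| / σ * (c / (c - 1))) - Real.arctan (|μ| / σ * (c / (c + 1)))) /
        Real.pi := by
  have h1 : 0 < c - 1 := by linarith
  have h2 : 0 < c + 1 := by linarith
  rcases le_total 0 μ with hμ | hμ
  · have hle : -(μ / (c - 1)) ≤ μ / (c + 1) :=
      (neg_nonpos.2 (by positivity)).trans (by positivity)
    rw [setOf_mem_scaled_interval_compl_of_nonneg hc hμ, cauchyMeasure_Ioo μ hσ hle,
      abs_of_nonneg hμ,
      show (μ / (c + 1) - μ) / σ = -(μ / σ * (c / (c + 1))) by field_simp; ring,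
      show (-(μ / (c - 1)) - μ) / σ = -(μ / σ * (c / (c - 1))) by field_simp; ring,
      Real.arctan_neg, Real.arctan_neg]
    ring
  · have hle : μ / (c + 1) ≤ -(μ / (c - 1)) :=
      (div_nonpos_of_nonpos_of_nonneg hμ h2.le).trans
        (neg_nonneg.2 (div_nonpos_of_nonpos_of_nonneg hμ h1.le))
    rw [setOf_mem_scaled_interval_compl_of_nonpos hc hμ, cauchyMeasure_Ioo μ hσ hle,
      abs_of_nonpos hμ,
      show (μ / (c + 1) - μ) / σ = -μ / σ * (c / (c + 1)) by field_simp; ring,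
      show (-(μ / (c - 1)) - μ) / σ = -μ / σ * (c / (c - 1)) by field_simp; ring]

lemma cauchyMeasure_coverage (μ : ℝ) {σ c : ℝ} (hσ : 0 < σ) (hc : 1 < c) :
    (cauchyMeasure μ σ {x : ℝ | x - c * |x| ≤ μ ∧ μ ≤ x + c * |x|}).toReal =
      1 - (Real.arctan (|μ| / σ * (c / (c - 1))) - Real.arctan (|μ| / σ * (c / (c + 1)))) /
        Real.pi := by
  have := isProbabilityMeasure_cauchyMeasure μ hσ
  have hmeas : MeasurableSet {x : ℝ | x - c * |x| ≤ μ ∧ μ ≤ x + c * |x|} :=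
    MeasurableSet.inter (s₁ := {x : ℝ | x - c * |x| ≤ μ}) (s₂ := {x : ℝ | μ ≤ x + c * |x|})
      (measurableSet_le (by fun_prop) (by fun_prop))
      (measurableSet_le (by fun_prop) (by fun_prop))
  have h := probReal_compl_eq_one_sub (μ := cauchyMeasure μ σ) hmeas
  rw [← cauchyMeasure_noncoverage μ hσ hc]
  simp only [Measure.real] at h
  linarith

lemma arctan_sub_arctan_of_inv_sin {θ t : ℝ} (hθ : 0 < θ) (hθ' : θ < Real.pi / 2) (ht : 0 ≤ t) :
    Real.arctan (t * ((Real.sin θ)⁻¹ / ((Real.sin θ)⁻¹ - 1))) -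
        Real.arctan (t * ((Real.sin θ)⁻¹ / ((Real.sin θ)⁻¹ + 1))) =
      Real.arctan (2 * t * Real.sin θ / (Real.cos θ ^ 2 + t ^ 2)) := by
  have hk : 0 < Real.cos θ := Real.cos_pos_of_mem_Ioo ⟨by linarith, hθ'⟩
  have hs : 0 < Real.sin θ := Real.sin_pos_of_pos_of_lt_pi hθ (by linarith)
  have hsk := Real.sin_sq_add_cos_sq θ
  generalize Real.cos θ = k at *
  generalize Real.sin θ = s at *
  have h1 : 0 < 1 - s := by nlinarith
  have h2 : 0 < 1 + s := by linarith
  rw [show s⁻¹ / (s⁻¹ - 1) = 1 / (1 - s) by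
      rw [show s⁻¹ - 1 = (1 - s) / s by field_simp]; field_simp,
    show s⁻¹ / (s⁻¹ + 1) = 1 / (1 + s) by
      rw [show s⁻¹ + 1 = (1 + s) / s by field_simp]; field_simp,
    sub_eq_add_neg, ← Real.arctan_neg, Real.arctan_add]
  · have hk2 : k ^ 2 = (1 - s) * (1 + s) := by linarith
    rw [hk2]
    have hpos : 0 < (1 - s) * (1 + s) + t ^ 2 := by positivity
    rw [show 1 - t * (1 / (1 - s)) * -(t * (1 / (1 + s))) =
        ((1 - s) * (1 + s) + t ^ 2) / ((1 - s) * (1 + s)) by field_simp; ring]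
    congr 1
    field_simp
    ring
  · have : 0 ≤ t * (1 / (1 - s)) * (t * (1 / (1 + s))) := by positivity
    linarith

theorem statement16 (α : ℝ) (hα : 0 < α) (hα' : α < 1 / 2) :
    ∃ c : ℝ, 1 < c ∧
      sInf {p : ℝ | ∃ μ σ : ℝ, 0 < σ ∧
          p = ((cauchyMeasure μ σ) {x : ℝ | x - c * |x| ≤ μ ∧ μ ≤ x + c * |x|}).toReal} =
        1 - α := by
  have hπ := Real.pi_pos
  obtain ⟨θ, rfl⟩ : ∃ θ, α = θ / Real.pi := ⟨α * Real.pi, by field_simp⟩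
  have hθ : 0 < θ := (div_pos_iff_of_pos_right hπ).1 hα
  have hθ' : θ < Real.pi / 2 := by rw [div_lt_iff₀ hπ] at hα'; linarith
  have hk : 0 < Real.cos θ := Real.cos_pos_of_mem_Ioo ⟨by linarith, hθ'⟩
  have hs : 0 < Real.sin θ := Real.sin_pos_of_pos_of_lt_pi hθ (by linarith)
  have hc : 1 < (Real.sin θ)⁻¹ :=
    (one_lt_inv₀ hs).2 (by nlinarith [Real.sin_sq_add_cos_sq θ])
  have htan : Real.arctan (Real.sin θ / Real.cos θ) = θ := by
    rw [← Real.tan_eq_sin_div_cos, Real.arctan_tan (by linarith) hθ']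
  refine ⟨(Real.sin θ)⁻¹, hc, IsLeast.csInf_eq ⟨⟨Real.cos θ, 1, one_pos, ?_⟩, ?_⟩⟩
  · rw [cauchyMeasure_coverage _ one_pos hc,
      arctan_sub_arctan_of_inv_sin hθ hθ' (by positivity), div_one, abs_of_pos hk,
      show 2 * Real.cos θ * Real.sin θ / (Real.cos θ ^ 2 + Real.cos θ ^ 2) =
        Real.sin θ / Real.cos θ by field_simp; ring, htan]
  · rintro _ ⟨μ, σ, hσ, rfl⟩
    rw [cauchyMeasure_coverage _ hσ hc, arctan_sub_arctan_of_inv_sin hθ hθ' (by positivity)]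
    gcongr
    conv_rhs => rw [← htan]
    refine Real.arctan_mono ?_
    rw [div_le_div_iff₀ (by positivity) hk]
    nlinarith [mul_nonneg hs.le (sq_nonneg (Real.cos θ - |μ| / σ))]
end

section
/- Let X be a real random variable on a probability space such that a ≤ |X| ≤ b almost surely, where 0 < a < b < ∞. Let σ² = Var(X), let K² = 4/((b/a + a/b)²), and let α satisfy 1 − K² < α < 1. Set c² = 1 − √(1−α)/K (which is positive). Then P(σ² ≤ X²/c²) ≥ 1 − α. -/
open MeasureTheory ProbabilityTheory

/-- A Paley–Zygmund type inequality for a random variable with values in `[l, u]`. -/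
theorem le_measureReal_of_forall_notMem_le {Ω : Type*} [MeasurableSpace Ω] {P : Measure Ω}
    [IsProbabilityMeasure P] {Y : Ω → ℝ} (hY : Integrable Y P) {l u r t : ℝ}
    (hr : 0 ≤ r) (ht : 0 ≤ t) (hb : ∀ᵐ ω ∂P, l ≤ Y ω ∧ Y ω ≤ u)
    {A : Set Ω} (hA : MeasurableSet A) (hAr : ∀ ω ∉ A, Y ω ≤ r) :
    2 * t * (P[Y] - r) - t ^ 2 * ((l + u) * P[Y] - l * u) ≤ P.real A := by
  have hint : ∫ ω, ((2 * t - t ^ 2 * (l + u)) * Y ω + (t ^ 2 * (l * u) - 2 * t * r)) ∂P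
      ≤ ∫ ω, A.indicator (fun _ ↦ (1 : ℝ)) ω ∂P := by
    refine integral_mono_ae ((hY.const_mul _).add (integrable_const _))
      ((integrable_const _).indicator hA) ?_
    filter_upwards [hb] with ω ⟨h₁, h₂⟩
    have hsq : t ^ 2 * Y ω ^ 2 ≤ t ^ 2 * ((l + u) * Y ω - l * u) := by
      gcongr
      nlinarith [mul_nonneg (sub_nonneg.2 h₁) (sub_nonneg.2 h₂)]
    by_cases hω : ω ∈ A
    · rw [Set.indicator_of_mem hω]
      nlinarith [sq_nonneg (t * Y ω - 1), mul_nonneg ht hr]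
    · rw [Set.indicator_of_notMem hω]
      nlinarith [mul_nonneg ht (sub_nonneg.2 (hAr ω hω)), sq_nonneg (t * Y ω)]
  rw [integral_add (hY.const_mul _) (integrable_const _), integral_const_mul,
    integral_indicator_const _ hA] at hint
  simp only [integral_const, probReal_univ, smul_eq_mul, one_mul, mul_one] at hint
  linarith

theorem statement17 {Ω : Type*} [MeasurableSpace Ω] (P : Measure Ω) [IsProbabilityMeasure P]
    (X : Ω → ℝ) (hX : Measurable X)
    (a b : ℝ) (ha : 0 < a) (hab : a < b)
    (hbound : ∀ᵐ ω ∂P, a ≤ |X ω| ∧ |X ω| ≤ b)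
    (K : ℝ) (hK : K = 2 / (b / a + a / b))
    (α : ℝ) (hαK : 1 - K ^ 2 < α) (hα' : α < 1)
    (c2 : ℝ) (hc2 : c2 = 1 - Real.sqrt (1 - α) / K) :
    0 < c2 ∧
      1 - α ≤ (P {ω | variance X P ≤ (X ω) ^ 2 / c2}).toReal := by
  have hb : 0 < b := ha.trans hab
  have hKpos : 0 < K := by rw [hK]; positivity
  have hKS : K * (a ^ 2 + b ^ 2) = 2 * (a * b) := by
    rw [hK]; field_simp; ring
  set s := √(1 - α) with hs
  have hs0 : 0 ≤ s := Real.sqrt_nonneg _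
  have hs2 : s ^ 2 = 1 - α := Real.sq_sqrt (by linarith)
  have hsK : s < K := by
    rw [hs, Real.sqrt_lt' hKpos]; linarith
  have hc : 0 < c2 := by
    rw [hc2, sub_pos, div_lt_one hKpos]; exact hsK
  refine ⟨hc, ?_⟩
  have hY : ∀ᵐ ω ∂P, a ^ 2 ≤ (X ^ 2) ω ∧ (X ^ 2) ω ≤ b ^ 2 := by
    filter_upwards [hbound] with ω ⟨h₁, h₂⟩
    rw [Pi.pow_apply, ← sq_abs (X ω)]
    constructor <;> gcongr
  have hYint : Integrable (X ^ 2) P :=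
    Integrable.of_mem_Icc (a ^ 2) (b ^ 2) (hX.pow_const 2).aemeasurable hY
  set m := P[X ^ 2] with hm
  have hma : a ^ 2 ≤ m := by
    have := integral_mono_ae (integrable_const (a ^ 2)) hYint (hY.mono fun ω h ↦ h.1)
    simpa [hm] using this
  have hm0 : 0 < m := lt_of_lt_of_le (by positivity) hma
  have hvar : variance X P ≤ m := variance_le_expectation_sq hX.aestronglyMeasurable
  have hmeas : MeasurableSet {ω | variance X P ≤ (X ω) ^ 2 / c2} :=
    measurableSet_le measurable_const ((hX.pow_const 2).div_const c2)
  have key := le_measureReal_of_forall_notMem_le (t := K * s / m) hYint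
    (mul_pos hm0 hc).le (by positivity) hY hmeas (fun ω hω ↦ by
      have h : X ω ^ 2 / c2 ≤ m := (not_le.1 hω).le.trans hvar
      exact (div_le_iff₀ hc).1 h)
  refine le_trans ?_ key
  rw [← hm, ← hs2]
  have hlin : 2 * (K * s / m) * (m - m * c2) = 2 * s ^ 2 := by
    rw [hc2]; field_simp; ring
  have hquad : K ^ 2 * ((a ^ 2 + b ^ 2) * m - a ^ 2 * b ^ 2) ≤ m ^ 2 := by
    have : K ^ 2 * ((a ^ 2 + b ^ 2) * m - a ^ 2 * b ^ 2) = m ^ 2 - (m - K * (a * b)) ^ 2 := by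
      linear_combination K * m * hKS
    nlinarith [sq_nonneg (m - K * (a * b))]
  have hquad' : (K * s / m) ^ 2 * ((a ^ 2 + b ^ 2) * m - a ^ 2 * b ^ 2) ≤ s ^ 2 := by
    calc _ = (s / m) ^ 2 * (K ^ 2 * ((a ^ 2 + b ^ 2) * m - a ^ 2 * b ^ 2)) := by ring
      _ ≤ (s / m) ^ 2 * m ^ 2 := by gcongr
      _ = s ^ 2 := by field_simp
  linarith
end

section
/- Let X be a real random variable on a probability space such that a ≤ |X| ≤ b almost surely, where 0 < a < b < ∞. Then E[X⁴] ≤ ((b/a + a/b)²/4) · (E[X²])². -/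
open MeasureTheory

theorem statement18 {Ω : Type*} [MeasurableSpace Ω] (P : Measure Ω) [IsProbabilityMeasure P]
    (X : Ω → ℝ) (hX : Measurable X)
    (a b : ℝ) (ha : 0 < a) (hab : a < b)
    (hbound : ∀ᵐ ω ∂P, a ≤ |X ω| ∧ |X ω| ≤ b) :
    ∫ ω, (X ω) ^ 4 ∂P ≤ ((b / a + a / b) ^ 2 / 4) * (∫ ω, (X ω) ^ 2 ∂P) ^ 2 := by
  have hb : 0 < b := ha.trans hab
  have integrable_pow (n : ℕ) : Integrable (fun ω => X ω ^ n) P := by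
    refine Integrable.of_bound (hX.pow_const n).aestronglyMeasurable (b ^ n) ?_
    filter_upwards [hbound] with ω hω
    rw [norm_pow, Real.norm_eq_abs]
    exact pow_le_pow_left₀ (abs_nonneg _) hω.2 n
  have chord_bound : ∫ ω, X ω ^ 4 ∂P ≤ (a ^ 2 + b ^ 2) * ∫ ω, X ω ^ 2 ∂P - a ^ 2 * b ^ 2 := by
    have h_int : Integrable (fun ω => (a ^ 2 + b ^ 2) * X ω ^ 2) P :=
      (integrable_pow 2).const_mul _
    calc ∫ ω, X ω ^ 4 ∂P
        ≤ ∫ ω, ((a ^ 2 + b ^ 2) * X ω ^ 2 - a ^ 2 * b ^ 2) ∂P := by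
          refine integral_mono_ae (integrable_pow 4) (h_int.sub (integrable_const _)) ?_
          filter_upwards [hbound] with ω ⟨hl, hu⟩
          have hl2 : a ^ 2 ≤ X ω ^ 2 := by
            simpa only [sq_abs] using pow_le_pow_left₀ ha.le hl 2
          have hu2 : X ω ^ 2 ≤ b ^ 2 := by
            simpa only [sq_abs] using pow_le_pow_left₀ (abs_nonneg _) hu 2
          nlinarith [mul_nonneg (sub_nonneg.2 hl2) (sub_nonneg.2 hu2)]
      _ = (a ^ 2 + b ^ 2) * ∫ ω, X ω ^ 2 ∂P - a ^ 2 * b ^ 2 := by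
          rw [integral_sub h_int (integrable_const _), integral_const_mul]
          simp
  refine chord_bound.trans ?_
  generalize ∫ ω, X ω ^ 2 ∂P = m
  have complete_square : (b / a + a / b) ^ 2 / 4 * m ^ 2 - ((a ^ 2 + b ^ 2) * m - a ^ 2 * b ^ 2) =
      ((b / a + a / b) / 2 * m - a * b) ^ 2 := by
    field_simp
    ring
  exact sub_nonneg.1 (complete_square ▸ sq_nonneg _)
end
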